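/- arXiv:math/0211107 — 3 statements merged into one kernel-verified Lean document; each statement's English description precedes it below -/
import Mathlib

section
/- Let q be a prime power, F_q the finite field with q elements, and E an elliptic curve defined over F_q with n = #E(F_q) rational points. For every k with 3 ≤ k ≤ n−1, the k-elliptic code C associated to E is a linear code of length n and dimension k over F_q which is either near-MDS or MDS. -/
set_option linter.unusedSectionVars false

namespace NMDS

open WeierstrassCurve

variable {F : Type} [Field F] [Fintype F] [DecidableEq F]

/-- `ψ_i(X,Y)`: `Y^s` if `i = 3s` (`s ≥ 1`), `X·Y^s` if `i = 3s+2` (`s ≥ 0`),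
`X²·Y^s` if `i = 3s+4` (`s ≥ 0`). -/
def psi (i : ℕ) (X Y : F) : F :=
  if i % 3 = 0 then Y ^ (i / 3)
  else if i % 3 = 2 then X * Y ^ (i / 3)
  else X ^ 2 * Y ^ ((i - 4) / 3)

/-- The coordinate vector of `φ_k(P)`: `(1, ψ₂(P), …, ψ_k(P))` for an affine point `P`,
and `(0, …, 0, 1)` for the point at infinity. -/
def phiVec (W : WeierstrassCurve F) (k : ℕ) : W.toAffine.Point → (Fin k → F)
  | .zero => fun j => if (j : ℕ) = k - 1 then 1 else 0
  | .some (x := x) (y := y) _ => fun j => if (j : ℕ) = 0 then 1 else psi ((j : ℕ) + 1) x y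

lemma phiVec_ne_zero (W : WeierstrassCurve F) {k : ℕ} (hk : 0 < k)
    (P : W.toAffine.Point) : phiVec W k P ≠ 0 := by
  cases P with
  | zero =>
    intro h
    have := congrFun h ⟨k - 1, by omega⟩
    simp [phiVec] at this
  | some h' =>
    intro h
    have := congrFun h ⟨0, hk⟩
    simp [phiVec] at this

/-- The image of a rational point of `E` in `P^{k-1}(F_q)` under `φ_k`. -/
noncomputable def phiProj (W : WeierstrassCurve F) {k : ℕ} (hk : 0 < k)
    (P : W.toAffine.Point) : Projectivization F (Fin k → F) :=
  Projectivization.mk F (phiVec W k P) (phiVec_ne_zero W hk P)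

/-- The `k`-elliptic code associated to `E`, relative to an enumeration `e` of the `n`
rational points of `E`: the span of the rows of the `k × n` matrix whose `j`-th column
is `φ_k(P_j)`. -/
def ellipticCode (W : WeierstrassCurve F) (k : ℕ) {n : ℕ}
    (e : Fin n ≃ W.toAffine.Point) : Submodule F (Fin n → F) :=
  Submodule.span F (Set.range fun i : Fin k => fun j : Fin n => phiVec W k (e j) i)

/-- The minimum distance (= minimum weight) of a linear code. -/
noncomputable def minDist {n : ℕ} (C : Submodule F (Fin n → F)) : ℕ :=
  sInf {d | ∃ x ∈ C, x ≠ 0 ∧ hammingNorm x = d}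

/-- The standard inner product with `y` as a linear map. -/
def dotLin {n : ℕ} (y : Fin n → F) : (Fin n → F) →ₗ[F] F where
  toFun x := ∑ i, x i * y i
  map_add' a b := by simp [add_mul, Finset.sum_add_distrib]
  map_smul' c a := by simp [Finset.mul_sum, mul_assoc]

/-- The dual code: all vectors orthogonal to every codeword. -/
def dualCode {n : ℕ} (C : Submodule F (Fin n → F)) : Submodule F (Fin n → F) :=
  ⨅ y ∈ C, LinearMap.ker (dotLin y)

/-- The Singleton defect `s(C) = n - k + 1 - d` of a code of length `n`. -/
noncomputable def singletonDefect {n : ℕ} (C : Submodule F (Fin n → F)) : ℤ :=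
  (n : ℤ) + 1 - Module.finrank F C - minDist C

/-- A code is MDS if its Singleton defect is zero. -/
noncomputable def IsMDS {n : ℕ} (C : Submodule F (Fin n → F)) : Prop :=
  singletonDefect C = 0

/-- A code is near-MDS if both it and its dual have Singleton defect one. -/
noncomputable def IsNMDS {n : ℕ} (C : Submodule F (Fin n → F)) : Prop :=
  singletonDefect C = 1 ∧ singletonDefect (dualCode C) = 1

/-- An `[n,k,d]_q` code `C` is `h`-extendable if there is an `[n+h,k,d+h]_q` code `C'`
whose projection on the first `n` coordinates is `C`. -/
noncomputable def IsHExtendable {n : ℕ} (h : ℕ) (C : Submodule F (Fin n → F)) : Prop :=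
  ∃ C' : Submodule F (Fin (n + h) → F),
    Module.finrank F C' = Module.finrank F C ∧
    minDist C' = minDist C + h ∧
    Submodule.map (LinearMap.funLeft F F (Fin.castAdd h)) C' = C

/-- The point `p` of `P^{k-1}(F_q)` lies on the hyperplane with coefficient vector `a`. -/
def OnHyp {k : ℕ} (a : Fin k → F) (p : Projectivization F (Fin k → F)) : Prop :=
  ∑ i, a i * p.rep i = 0

/-- An `(·; k, k-2)`-set in `P^{k-1}(F_q)`: no `k+1` of its points lie on a common hyperplane,
i.e. every hyperplane contains at most `k` of its points. -/
def IsArcSet (k : ℕ) (S : Set (Projectivization F (Fin k → F))) : Prop :=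
  ∀ a : Fin k → F, a ≠ 0 → Set.ncard {p ∈ S | OnHyp a p} ≤ k

/-- A complete `(·; k, k-2)`-set: maximal with respect to set-theoretical inclusion. -/
def IsCompleteArcSet (k : ℕ) (S : Set (Projectivization F (Fin k → F))) : Prop :=
  IsArcSet k S ∧ ∀ T, IsArcSet k T → S ⊆ T → T = S

/-- Evaluation of the homogeneous cubic of a Weierstrass curve:
`Y²Z + a₁XYZ + a₃YZ² - X³ - a₂X²Z - a₄XZ² - a₆Z³`. -/
def cubicEval {R : Type*} [CommRing R] (W : WeierstrassCurve R) (x y z : R) : R :=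
  y ^ 2 * z + W.a₁ * x * y * z + W.a₃ * y * z ^ 2
    - (x ^ 3 + W.a₂ * x ^ 2 * z + W.a₄ * x * z ^ 2 + W.a₆ * z ^ 3)

/-- The gradient of the homogeneous cubic of a Weierstrass curve. -/
def gradEval {R : Type*} [CommRing R] (W : WeierstrassCurve R) (x y z : R) : Fin 3 → R :=
  ![W.a₁ * y * z - (3 * x ^ 2 + 2 * W.a₂ * x * z + W.a₄ * z ^ 2),
    2 * y * z + W.a₁ * x * z + W.a₃ * z ^ 2,
    y ^ 2 + W.a₁ * x * y + 2 * W.a₃ * y * z - (W.a₂ * x ^ 2 + 2 * W.a₄ * x * z + 3 * W.a₆ * z ^ 2)]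

/-- The point `p` of `P²(F_q)` lies on the plane cubic `E`. -/
def OnCurve (W : WeierstrassCurve F) (p : Projectivization F (Fin 3 → F)) : Prop :=
  cubicEval W (p.rep 0) (p.rep 1) (p.rep 2) = 0

/-- A line of `P²(F_q)`, given by its coefficient vector `l`, is a tangent of `E`:
it touches the curve at some point (over the algebraic closure) with multiplicity at
least two, i.e. it is the tangent line of the cubic at a contact point. -/
def IsTangentLine (W : WeierstrassCurve F) (l : Fin 3 → F) : Prop :=
  ∃ v : Fin 3 → AlgebraicClosure F, v ≠ 0 ∧
    cubicEval (W.baseChange (AlgebraicClosure F)) (v 0) (v 1) (v 2) = 0 ∧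
    (∑ i, algebraMap F (AlgebraicClosure F) (l i) * v i) = 0 ∧
    ∃ t : AlgebraicClosure F, t ≠ 0 ∧
      gradEval (W.baseChange (AlgebraicClosure F)) (v 0) (v 1) (v 2) =
        t • fun i => algebraMap F (AlgebraicClosure F) (l i)

/-- A line of `P²(F_q)` intersects `E` in three distinct `F_q`-rational points. -/
def IsThreeSecant (W : WeierstrassCurve F) (l : Fin 3 → F) : Prop :=
  ∃ u v w : Projectivization F (Fin 3 → F), u ≠ v ∧ u ≠ w ∧ v ≠ w ∧
    OnCurve W u ∧ OnCurve W v ∧ OnCurve W w ∧ OnHyp l u ∧ OnHyp l v ∧ OnHyp l w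


section Proof

open Polynomial

/-! ### Pole orders in the affine coordinate ring -/

section CoordinateRing

variable {K : Type*} [Field K] {W : WeierstrassCurve K}

open Affine.CoordinateRing

/-- The pole order at infinity of a function on the affine curve: the degree of its norm. -/
noncomputable def poleOrder (f : W.toAffine.CoordinateRing) : WithBot ℕ :=
  (Algebra.norm K[X] f).degree

lemma poleOrder_smul_basis (p q : K[X]) :
    poleOrder (p • (1 : W.toAffine.CoordinateRing) + q • Affine.CoordinateRing.mk W.toAffine X) =
      max (2 • p.degree) (2 • q.degree + 3) :=
  degree_norm_smul_basis p q

lemma poleOrder_mul (f g : W.toAffine.CoordinateRing) :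
    poleOrder (f * g) = poleOrder f + poleOrder g := by
  simp [poleOrder]

lemma poleOrder_pow (f : W.toAffine.CoordinateRing) (s : ℕ) :
    poleOrder (f ^ s) = s • poleOrder f := by
  simp [poleOrder]

lemma poleOrder_one : poleOrder (1 : W.toAffine.CoordinateRing) = 0 := by
  simp [poleOrder]

lemma poleOrder_zero : poleOrder (0 : W.toAffine.CoordinateRing) = ⊥ := by
  simpa using poleOrder_smul_basis (W := W) 0 0

lemma poleOrder_neg (f : W.toAffine.CoordinateRing) : poleOrder (-f) = poleOrder f := by
  have h := poleOrder_mul (-1) f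
  have h1 : poleOrder (-1 : W.toAffine.CoordinateRing) = 0 := by
    simpa using poleOrder_smul_basis (W := W) (-1) 0
  rwa [h1, zero_add, neg_one_mul] at h

lemma poleOrder_add_le (f g : W.toAffine.CoordinateRing) :
    poleOrder (f + g) ≤ max (poleOrder f) (poleOrder g) := by
  obtain ⟨p, q, rfl⟩ := exists_smul_basis_eq f
  obtain ⟨r, s, rfl⟩ := exists_smul_basis_eq g
  have hsum : p • (1 : W.toAffine.CoordinateRing) + q • Affine.CoordinateRing.mk W.toAffine X +
      (r • (1 : W.toAffine.CoordinateRing) + s • Affine.CoordinateRing.mk W.toAffine X) =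
      (p + r) • (1 : W.toAffine.CoordinateRing) +
        (q + s) • Affine.CoordinateRing.mk W.toAffine X := by
    rw [add_smul, add_smul]; abel
  rw [hsum, poleOrder_smul_basis, poleOrder_smul_basis, poleOrder_smul_basis]
  rcases le_total p.degree r.degree with hp | hp <;>
  rcases le_total q.degree s.degree with hq | hq
  all_goals
    have h1 := degree_add_le p r
    have h2 := degree_add_le q s
    simp only [hp, hq, max_eq_left, max_eq_right] at h1 h2
    refine max_le ?_ ?_
    · refine (nsmul_le_nsmul_right h1 2).trans ?_
      simp
    · refine (add_le_add_left (nsmul_le_nsmul_right h2 2) 3).trans ?_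
      simp

lemma poleOrder_smul_le (c : K) (f : W.toAffine.CoordinateRing) :
    poleOrder (c • f) ≤ poleOrder f := by
  have h1 : poleOrder (c • (1 : W.toAffine.CoordinateRing)) ≤ 0 := by
    have h := poleOrder_smul_basis (W := W) (C c) 0
    rw [zero_smul, add_zero] at h
    have hc : (C c : K[X]) • (1 : W.toAffine.CoordinateRing) = c • 1 := by
      rw [← smul_one_smul K[X] c (1 : W.toAffine.CoordinateRing), smul_eq_C_mul, mul_one]
    rw [hc] at h
    rw [h]
    have := degree_C_le (a := c)
    simpa using nsmul_le_nsmul_right this 2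
  have h := poleOrder_mul (c • 1) f
  rw [smul_one_mul] at h
  rw [h]
  simpa using add_le_add_left h1 (poleOrder f)

lemma poleOrder_sum_le {ι : Type*} (s : Finset ι) (f : ι → W.toAffine.CoordinateRing)
    {d : WithBot ℕ} (h : ∀ i ∈ s, poleOrder (f i) ≤ d) : poleOrder (∑ i ∈ s, f i) ≤ d :=
  Finset.sum_induction f (poleOrder · ≤ d)
    (fun a b ha hb => (poleOrder_add_le a b).trans (max_le ha hb)) (by simp [poleOrder_zero]) h

lemma poleOrder_sum_lt {ι : Type*} (s : Finset ι) (f : ι → W.toAffine.CoordinateRing)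
    {d : WithBot ℕ} (hd : ⊥ < d) (h : ∀ i ∈ s, poleOrder (f i) < d) :
    poleOrder (∑ i ∈ s, f i) < d :=
  Finset.sum_induction f (poleOrder · < d)
    (fun a b ha hb => (poleOrder_add_le a b).trans_lt (max_lt ha hb))
    (by simpa [poleOrder_zero] using hd) h

lemma poleOrder_eq_bot_iff {f : W.toAffine.CoordinateRing} : poleOrder f = ⊥ ↔ f = 0 := by
  have := Module.Finite.of_basis (Affine.CoordinateRing.basis W.toAffine)
  rw [poleOrder, degree_eq_bot, Algebra.norm_eq_zero_iff]

/-- The only functions with at most a simple pole at infinity are the constants. -/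
lemma exists_eq_smul_one_of_poleOrder_le_one {f : W.toAffine.CoordinateRing}
    (hf : poleOrder f ≤ 1) : ∃ c : K, f = c • 1 := by
  obtain ⟨p, q, rfl⟩ := exists_smul_basis_eq f
  rw [poleOrder_smul_basis, max_le_iff] at hf
  have hq : q = 0 := by
    by_contra hq
    have h := hf.2
    rw [degree_eq_natDegree hq, nsmul_eq_mul] at h
    have h' : 2 * q.natDegree + 3 ≤ 1 := by exact_mod_cast h
    omega
  have hp : p.natDegree = 0 := by
    by_cases hp0 : p = 0
    · simp [hp0]
    · have h := hf.1
      rw [degree_eq_natDegree hp0, nsmul_eq_mul] at h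
      have h' : 2 * p.natDegree ≤ 1 := by exact_mod_cast h
      omega
  refine ⟨p.coeff 0, ?_⟩
  rw [hq, zero_smul, add_zero, ← smul_one_smul K[X] (p.coeff 0) (1 : W.toAffine.CoordinateRing),
    smul_eq_C_mul, mul_one, ← eq_C_of_natDegree_eq_zero hp]

lemma finite_quotient_span_singleton {f : W.toAffine.CoordinateRing} (hf : f ≠ 0) :
    Module.Finite K (W.toAffine.CoordinateRing ⧸ Ideal.span {f}) := by
  have hI : Ideal.span {f} ≠ ⊥ := by simpa using hf
  have (i : Fin 2) : Module.Finite K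
      (K[X] ⧸ Ideal.span {(Ideal.span {f}).smithCoeffs (Affine.CoordinateRing.basis W.toAffine)
        hI i}) := inferInstance
  exact Module.Finite.equiv
    ((Ideal.span {f}).quotientEquivDirectSum K (Affine.CoordinateRing.basis W.toAffine) hI ≪≫ₗ
      DirectSum.linearEquivFunOnFintype K _ _).symm

lemma finrank_quotient_span_singleton {f : W.toAffine.CoordinateRing} (hf : f ≠ 0) :
    (Module.finrank K (W.toAffine.CoordinateRing ⧸ Ideal.span {f}) : WithBot ℕ) = poleOrder f := by
  rw [finrank_quotient_span_eq_natDegree_norm (Affine.CoordinateRing.basis W.toAffine) hf,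
    poleOrder, degree_eq_natDegree]
  rwa [← degree_ne_bot, ← poleOrder, Ne, poleOrder_eq_bot_iff]

end CoordinateRing

/-! ### Functions vanishing at given points -/

/-- Evaluation at finitely many distinct rational points is surjective. -/
lemma pi_algHom_surjective {K A ι : Type*} [Field K] [CommRing A] [Algebra K A] [Finite ι]
    {P : ι → A →ₐ[K] K} (hP : Function.Injective P) :
    Function.Surjective (LinearMap.pi fun i => (P i).toLinearMap) := by
  classical
  have := Fintype.ofFinite ι
  rw [← LinearMap.range_eq_top]
  by_contra hne
  obtain ⟨φ, hφ, hle⟩ := Submodule.exists_le_ker_of_lt_top _ (lt_top_iff_ne_top.2 hne)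
  have hind : LinearIndependent K fun i => (P i : A → K) :=
    (linearIndependent_monoidHom A K).comp (fun i => (P i : A →* K)) fun i j hij =>
      hP <| AlgHom.ext fun a => DFunLike.congr_fun hij a
  refine hφ <| LinearMap.pi_ext' fun i => LinearMap.ext_ring ?_
  refine Fintype.linearIndependent_iff.1 hind (fun i => φ (Pi.single i 1)) ?_ i
  funext a
  have ha : φ (fun i => P i a) = 0 := hle ⟨a, rfl⟩
  rw [pi_eq_sum_univ' (fun i => P i a), map_sum] at ha
  simpa [mul_comm] using ha

section Vanishing

variable {K : Type*} [Field K] {W : WeierstrassCurve K} {ι : Type*} [Fintype ι]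
  {P : ι → W.toAffine.CoordinateRing →ₐ[K] K}

lemma exists_quotient_map_surjective (hP : Function.Injective P)
    {f : W.toAffine.CoordinateRing} (hf : ∀ i, P i f = 0) :
    ∃ φ : (W.toAffine.CoordinateRing ⧸ Ideal.span {f}) →ₗ[K] ι → K,
      Function.Surjective φ ∧ ∀ g i, φ (Ideal.Quotient.mk _ g) i = P i g := by
  refine ⟨LinearMap.pi fun i => (Ideal.Quotient.liftₐ (Ideal.span {f}) (P i) ?_).toLinearMap,
    ?_, fun g i => rfl⟩
  · intro a ha
    obtain ⟨b, rfl⟩ := Ideal.mem_span_singleton.1 ha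
    simp [hf i]
  · intro v
    obtain ⟨a, rfl⟩ := pi_algHom_surjective hP v
    exact ⟨Ideal.Quotient.mk _ a, rfl⟩

/-- A nonzero function has at most as many zeros as its pole order. -/
lemma card_le_poleOrder (hP : Function.Injective P) {f : W.toAffine.CoordinateRing} (hf0 : f ≠ 0)
    (hf : ∀ i, P i f = 0) : (Fintype.card ι : WithBot ℕ) ≤ poleOrder f := by
  obtain ⟨φ, hφ, -⟩ := exists_quotient_map_surjective hP hf
  have := finite_quotient_span_singleton hf0
  rw [← finrank_quotient_span_singleton hf0]
  have h := LinearMap.finrank_le_finrank_of_surjective hφ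
  rw [Module.finrank_pi] at h
  exact_mod_cast h

/-- If `f` has no zeros besides the given points, then every function vanishing there whose pole
order exceeds the number of points by at most one is a constant multiple of `f`. -/
lemma exists_eq_smul_of_vanish (hP : Function.Injective P) {f g : W.toAffine.CoordinateRing}
    (hf0 : f ≠ 0) (hf : ∀ i, P i f = 0) (hg : ∀ i, P i g = 0)
    (hdf : poleOrder f ≤ Fintype.card ι) (hdg : poleOrder g ≤ (Fintype.card ι + 1 : ℕ)) :
    ∃ c : K, g = c • f := by
  obtain ⟨φ, hφ, hφP⟩ := exists_quotient_map_surjective hP hf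
  have := finite_quotient_span_singleton hf0
  have hcard := le_antisymm hdf (card_le_poleOrder hP hf0 hf)
  have hrank : Module.finrank K (W.toAffine.CoordinateRing ⧸ Ideal.span {f}) =
      Module.finrank K (ι → K) := by
    have h := finrank_quotient_span_singleton hf0
    rw [hcard] at h
    rw [Module.finrank_pi]
    exact_mod_cast h
  have hinj := (LinearMap.injective_iff_surjective_of_finrank_eq_finrank hrank).2 hφ
  have hmem : g ∈ Ideal.span {f} := by
    rw [← Ideal.Quotient.eq_zero_iff_mem]
    refine hinj ?_
    rw [map_zero]
    funext i
    rw [hφP, hg, Pi.zero_apply]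
  obtain ⟨h, rfl⟩ := Ideal.mem_span_singleton.1 hmem
  rw [poleOrder_mul, hcard] at hdg
  have hh : poleOrder h ≤ 1 := by
    cases hd : poleOrder h with
    | bot => exact bot_le
    | coe m =>
      rw [hd] at hdg
      have : Fintype.card ι + m ≤ Fintype.card ι + 1 := WithBot.coe_le_coe.1 hdg
      have : m ≤ 1 := by omega
      exact WithBot.coe_le_coe.2 this
  obtain ⟨c, rfl⟩ := exists_eq_smul_one_of_poleOrder_le_one hh
  exact ⟨c, by simp⟩

end Vanishing

/-! ### Linear codes given by a generator matrix -/

section Codes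

open Matrix

variable {k n : ℕ} (G : Matrix (Fin k) (Fin n) F)

lemma hammingNorm_add_card_zeros (x : Fin n → F) :
    hammingNorm x + (Finset.univ.filter fun j => x j = 0).card = n := by
  have h := Finset.card_filter_add_card_filter_not (s := Finset.univ) fun j => x j = 0
  rw [Finset.card_univ, Fintype.card_fin] at h
  rw [add_comm]
  exact h

lemma minDist_le {C : Submodule F (Fin n → F)} {x : Fin n → F} (hx : x ∈ C) (hx0 : x ≠ 0) :
    minDist C ≤ hammingNorm x :=
  Nat.sInf_le ⟨x, hx, hx0, rfl⟩

lemma exists_hammingNorm_eq_minDist {C : Submodule F (Fin n → F)} (hC : C ≠ ⊥) :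
    ∃ x ∈ C, x ≠ 0 ∧ hammingNorm x = minDist C := by
  obtain ⟨x, hx, hx0⟩ := C.exists_mem_ne_zero_of_ne_bot hC
  exact Nat.sInf_mem (s := {d | ∃ x ∈ C, x ≠ 0 ∧ hammingNorm x = d}) ⟨_, x, hx, hx0, rfl⟩

lemma dualCode_range_vecMulLinear :
    dualCode (LinearMap.range G.vecMulLinear) = LinearMap.ker G.mulVecLin := by
  ext w
  simp only [dualCode, Submodule.mem_iInf, LinearMap.mem_ker, mulVecLin_apply]
  constructor
  · intro h
    funext i
    have := h (G.row i) ⟨Pi.single i 1, by simp⟩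
    simpa [dotLin, mulVec, dotProduct, mul_comm] using this
  · rintro h _ ⟨a, rfl⟩
    change w ⬝ᵥ (a ᵥ* G) = 0
    rw [dotProduct_comm, ← dotProduct_mulVec, h, dotProduct_zero]

lemma finrank_ker_mulVecLin_add (hG : Function.Injective G.vecMulLinear) :
    Module.finrank F (LinearMap.ker G.mulVecLin) + k = n := by
  have h := LinearMap.finrank_range_add_finrank_ker G.mulVecLin
  have hr : Module.finrank F (LinearMap.range G.mulVecLin) = k := by
    change G.rank = k
    rw [← rank_transpose, rank, mulVecLin_transpose, LinearMap.finrank_range_of_inj hG,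
      Module.finrank_fin_fun]
  rw [hr, Module.finrank_fin_fun] at h
  omega

/-- Restriction of codewords to the coordinates in `S`, as a map on coefficient vectors. -/
def restrictCode (S : Finset (Fin n)) : (Fin k → F) →ₗ[F] S → F :=
  (LinearMap.funLeft F F ((↑) : S → Fin n)).comp G.vecMulLinear

lemma restrictCode_eq_zero_iff {S : Finset (Fin n)} {a : Fin k → F} :
    restrictCode G S a = 0 ↔ ∀ j ∈ S, (a ᵥ* G) j = 0 :=
  ⟨fun h j hj => congrFun h ⟨j, hj⟩, fun h => funext fun j => h j j.2⟩

/-- Dual codewords supported in `S` are the linear forms vanishing on the restricted code. -/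
lemma mulVec_eq_zero_iff_restrictCode {S : Finset (Fin n)} {w : Fin n → F}
    (hw : ∀ j ∉ S, w j = 0) :
    G *ᵥ w = 0 ↔ ∀ a, restrictCode G S a ⬝ᵥ (fun j : S => w j) = 0 := by
  have key : ∀ a, restrictCode G S a ⬝ᵥ (fun j : S => w j) = a ⬝ᵥ (G *ᵥ w) := by
    intro a
    rw [dotProduct_mulVec]
    change ∑ j : S, (a ᵥ* G) j * w j = ∑ j, (a ᵥ* G) j * w j
    rw [Finset.sum_coe_sort S fun j => (a ᵥ* G) j * w j]
    exact Finset.sum_subset (Finset.subset_univ S) fun j _ hj => by rw [hw j hj, mul_zero]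
  simp_rw [key]
  constructor
  · intro h a
    rw [h, dotProduct_zero]
  · intro h
    exact dotProduct_eq_zero _ fun a => by rw [dotProduct_comm]; exact h a

lemma singleton_bound (hk : 1 ≤ k) (hkn : k ≤ n) (hG : Function.Injective G.vecMulLinear) :
    minDist (LinearMap.range G.vecMulLinear) + k ≤ n + 1 := by
  obtain ⟨S, -, hS⟩ := Finset.exists_subset_card_eq (s := (Finset.univ : Finset (Fin n)))
    (n := k - 1) (by rw [Finset.card_univ, Fintype.card_fin]; omega)
  have hker : LinearMap.ker (restrictCode G S) ≠ ⊥ := by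
    apply LinearMap.ker_ne_bot_of_finrank_lt
    rw [Module.finrank_fin_fun, Module.finrank_pi, Fintype.card_coe]
    omega
  obtain ⟨a, ha, ha0⟩ := Submodule.exists_mem_ne_zero_of_ne_bot hker
  rw [LinearMap.mem_ker, restrictCode_eq_zero_iff] at ha
  have hmin := minDist_le (C := LinearMap.range G.vecMulLinear) ⟨a, rfl⟩
    fun h => ha0 (hG (h.trans (map_zero _).symm))
  have hle : S.card ≤ (Finset.univ.filter fun j => G.vecMulLinear a j = 0).card :=
    Finset.card_le_card fun j hj => Finset.mem_filter.2 ⟨Finset.mem_univ j, ha j hj⟩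
  have := hammingNorm_add_card_zeros (G.vecMulLinear a)
  omega

/-- If some nonzero codeword vanishes on `S` with `|S| = k`, the dual code has a nonzero word
supported in `S`. -/
lemma minDist_dual_le_of_zeros {a : Fin k → F} (ha0 : a ≠ 0) {S : Finset (Fin n)}
    (hS : S.card = k) (ha : ∀ j ∈ S, (a ᵥ* G) j = 0) :
    minDist (LinearMap.ker G.mulVecLin) ≤ k := by
  have hlt : LinearMap.range (restrictCode G S) < ⊤ := by
    rw [lt_top_iff_ne_top, Ne, LinearMap.range_eq_top,
      ← LinearMap.injective_iff_surjective_of_finrank_eq_finrank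
        (by rw [Module.finrank_fin_fun, Module.finrank_pi, Fintype.card_coe, hS])]
    exact fun hinj => ha0 (hinj (((restrictCode_eq_zero_iff G).2 ha).trans (map_zero _).symm))
  obtain ⟨φ, hφ0, hφ⟩ := Submodule.exists_le_ker_of_lt_top _ hlt
  let w : Fin n → F := fun j => if hj : j ∈ S then φ (Pi.single ⟨j, hj⟩ 1) else 0
  have hwS : ∀ j : S, w j = φ (Pi.single j 1) := fun j => by simp [w]
  have hw : ∀ j ∉ S, w j = 0 := fun j hj => by simp [w, hj]
  have hφw : ∀ v, φ v = v ⬝ᵥ fun j : S => w j := by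
    intro v
    conv_lhs => rw [pi_eq_sum_univ' v, map_sum]
    simp [dotProduct, hwS]
  have hw0 : w ≠ 0 := by
    rintro h
    refine hφ0 (LinearMap.ext fun v => ?_)
    rw [hφw, h]
    simp [dotProduct]
  have hmem : w ∈ LinearMap.ker G.mulVecLin := by
    rw [LinearMap.mem_ker, mulVecLin_apply, mulVec_eq_zero_iff_restrictCode G hw]
    exact fun a => by rw [← hφw]; exact hφ ⟨a, rfl⟩
  refine (minDist_le hmem hw0).trans ?_
  rw [← hS, hammingNorm]
  refine Finset.card_le_card fun j hj => ?_
  by_contra hjS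
  exact (Finset.mem_filter.1 hj).2 (hw j hjS)

/-- If the codewords vanishing on any `k - 1` coordinates form a space of dimension at most one,
nonzero dual codewords have weight at least `k`. -/
lemma le_hammingNorm_of_mulVec_eq_zero (hk : 1 ≤ k) (hkn : k ≤ n)
    (hG : ∀ S : Finset (Fin n), S.card = k - 1 →
      Module.finrank F (LinearMap.ker (restrictCode G S)) ≤ 1)
    {w : Fin n → F} (hw0 : w ≠ 0) (hw : G *ᵥ w = 0) : k ≤ hammingNorm w := by
  by_contra! hlt
  obtain ⟨S, hsub, -, hS⟩ := Finset.exists_subsuperset_card_eq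
    (s := Finset.univ.filter fun j => w j ≠ 0) (t := Finset.univ) (n := k - 1)
    (Finset.subset_univ _) (by rw [hammingNorm] at hlt; omega)
    (by rw [Finset.card_univ, Fintype.card_fin]; omega)
  have hwS : ∀ j ∉ S, w j = 0 := fun j hj => by
    by_contra h
    exact hj (hsub (Finset.mem_filter.2 ⟨Finset.mem_univ j, h⟩))
  have hrank := LinearMap.finrank_range_add_finrank_ker (restrictCode G S)
  rw [Module.finrank_fin_fun] at hrank
  have htop : LinearMap.range (restrictCode G S) = ⊤ := by
    apply Submodule.eq_top_of_finrank_eq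
    have hle := Submodule.finrank_le (LinearMap.range (restrictCode G S))
    have hker := hG S hS
    rw [Module.finrank_pi, Fintype.card_coe] at hle ⊢
    omega
  have hzero : (fun j : S => w j) = 0 := by
    refine dotProduct_eq_zero _ fun v => ?_
    obtain ⟨a, rfl⟩ := LinearMap.range_eq_top.1 htop v
    rw [dotProduct_comm]
    exact (mulVec_eq_zero_iff_restrictCode G hwS).1 hw a
  refine hw0 (funext fun j => ?_)
  by_cases hj : j ∈ S
  · exact congrFun hzero ⟨j, hj⟩
  · exact hwS j hj

/-- A `k × n` matrix such that nonzero codewords have at most `k` zeros and the codewords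
vanishing on `k - 1` coordinates form a space of dimension at most one generates a near-MDS or
MDS code of dimension `k`. -/
theorem isNMDS_or_isMDS_of_generator (hk : 1 ≤ k) (hkn : k < n)
    (hzeros : ∀ a : Fin k → F, a ≠ 0 → ∀ S : Finset (Fin n), (∀ j ∈ S, (a ᵥ* G) j = 0) →
      S.card ≤ k)
    (hker : ∀ S : Finset (Fin n), S.card = k - 1 →
      Module.finrank F (LinearMap.ker (restrictCode G S)) ≤ 1) :
    Module.finrank F (LinearMap.range G.vecMulLinear) = k ∧
      (IsNMDS (LinearMap.range G.vecMulLinear) ∨ IsMDS (LinearMap.range G.vecMulLinear)) := by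
  have hinj : Function.Injective G.vecMulLinear := by
    rw [injective_iff_map_eq_zero]
    intro a ha
    by_contra ha0
    have := hzeros a ha0 Finset.univ fun j _ => congrFun ha j
    rw [Finset.card_univ, Fintype.card_fin] at this
    omega
  have hdim : Module.finrank F (LinearMap.range G.vecMulLinear) = k := by
    rw [LinearMap.finrank_range_of_inj hinj, Module.finrank_fin_fun]
  refine ⟨hdim, ?_⟩
  have hne : LinearMap.range G.vecMulLinear ≠ ⊥ := fun h => by
    rw [h, finrank_bot] at hdim
    omega
  obtain ⟨_, ⟨a, rfl⟩, hx0, hx⟩ := exists_hammingNorm_eq_minDist hne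
  have ha0 : a ≠ 0 := fun h => hx0 (by rw [h, map_zero])
  have hcount := hammingNorm_add_card_zeros (G.vecMulLinear a)
  have hcard := hzeros a ha0 (Finset.univ.filter fun j => G.vecMulLinear a j = 0)
    fun j hj => (Finset.mem_filter.1 hj).2
  have hsing := singleton_bound G hk hkn.le hinj
  by_cases hd : minDist (LinearMap.range G.vecMulLinear) + k = n + 1
  · right
    rw [IsMDS, singletonDefect, hdim]
    omega
  · left
    refine ⟨by rw [singletonDefect, hdim]; omega, ?_⟩
    have hdual := finrank_ker_mulVecLin_add G hinj
    have hupper := minDist_dual_le_of_zeros G ha0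
      (S := Finset.univ.filter fun j => G.vecMulLinear a j = 0) (by omega)
      fun j hj => (Finset.mem_filter.1 hj).2
    have hdual_ne : LinearMap.ker G.mulVecLin ≠ ⊥ := fun h => by
      rw [h, finrank_bot] at hdual
      omega
    obtain ⟨w, hw, hw0, hwd⟩ := exists_hammingNorm_eq_minDist hdual_ne
    have hlower := le_hammingNorm_of_mulVec_eq_zero G hk hkn.le hker hw0 hw
    rw [dualCode_range_vecMulLinear, singletonDefect]
    omega

end Codes

/-! ### The functions `ψ_i` on the curve -/

section Functions

variable {W : WeierstrassCurve F}

/-- The coordinate function `x` on the affine curve. -/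
noncomputable def xFun (W : WeierstrassCurve F) : W.toAffine.CoordinateRing :=
  Affine.CoordinateRing.mk W.toAffine (C X)

/-- The coordinate function `y` on the affine curve. -/
noncomputable def yFun (W : WeierstrassCurve F) : W.toAffine.CoordinateRing :=
  Affine.CoordinateRing.mk W.toAffine X

/-- The `j`-th coordinate function of `φ_k`: the constant `1` for `j = 0`, otherwise `ψ_{j+1}`. -/
noncomputable def phiFun (W : WeierstrassCurve F) (j : ℕ) : W.toAffine.CoordinateRing :=
  if j = 0 then 1
  else if (j + 1) % 3 = 0 then yFun W ^ ((j + 1) / 3)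
  else if (j + 1) % 3 = 2 then xFun W * yFun W ^ ((j + 1) / 3)
  else xFun W ^ 2 * yFun W ^ ((j + 1 - 4) / 3)

lemma poleOrder_xFun : poleOrder (xFun W) = (2 : ℕ) := by
  have h := poleOrder_smul_basis (W := W) X 0
  rw [zero_smul, add_zero, Affine.CoordinateRing.smul, mul_one] at h
  rw [xFun, h]
  simp

lemma poleOrder_yFun : poleOrder (yFun W) = (3 : ℕ) := by
  have h := poleOrder_smul_basis (W := W) 0 1
  rw [zero_smul, zero_add, one_smul] at h
  rw [yFun, h]
  simp

lemma poleOrder_phiFun (j : ℕ) :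
    poleOrder (phiFun W j) = ((if j = 0 then 0 else j + 1 : ℕ) : WithBot ℕ) := by
  have key : ∀ r s : ℕ,
      poleOrder (xFun W ^ r * yFun W ^ s) = ((r * 2 + s * 3 : ℕ) : WithBot ℕ) := by
    intro r s
    rw [poleOrder_mul, poleOrder_pow, poleOrder_pow, poleOrder_xFun, poleOrder_yFun]
    simp only [nsmul_eq_mul]
    norm_cast
  unfold phiFun
  split_ifs with h0 h1 h2
  · simp [poleOrder_one]
  · have h := key 0 ((j + 1) / 3)
    rw [pow_zero, one_mul] at h
    rw [h]
    congr 1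
    omega
  · have h := key 1 ((j + 1) / 3)
    rw [pow_one] at h
    rw [h]
    congr 1
    omega
  · rw [key]
    congr 1
    omega

/-- The function on the affine curve with coefficient vector `a`. -/
noncomputable def combFun (W : WeierstrassCurve F) {k : ℕ} (a : Fin k → F) :
    W.toAffine.CoordinateRing :=
  ∑ j, a j • phiFun W j

lemma combFun_sub_smul {k : ℕ} (a b : Fin k → F) (c : F) :
    combFun W (a - c • b) = combFun W a - c • combFun W b := by
  simp [combFun, sub_smul, mul_smul, Finset.smul_sum, Finset.sum_sub_distrib]

lemma poleOrder_combFun_le {k m : ℕ} {a : Fin k → F} (ha : ∀ j : Fin k, m ≤ j → a j = 0) :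
    poleOrder (combFun W a) ≤ m := by
  refine poleOrder_sum_le _ _ fun j _ => ?_
  by_cases hj : m ≤ j
  · simp [ha j hj, poleOrder_zero]
  · refine (poleOrder_smul_le _ _).trans ?_
    rw [poleOrder_phiFun]
    norm_cast
    split_ifs <;> omega

lemma combFun_ne_zero {k : ℕ} {a : Fin k → F} (ha : a ≠ 0) : combFun W a ≠ 0 := by
  obtain ⟨i, hi⟩ := Function.ne_iff.1 ha
  obtain ⟨t, ht, hmax⟩ := Finset.exists_max_image (Finset.univ.filter fun j => a j ≠ 0) id
    ⟨i, Finset.mem_filter.2 ⟨Finset.mem_univ i, hi⟩⟩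
  have hat : a t ≠ 0 := (Finset.mem_filter.1 ht).2
  intro h0
  rw [combFun, ← Finset.add_sum_erase _ _ (Finset.mem_univ t)] at h0
  have hrest : poleOrder (∑ j ∈ Finset.univ.erase t, a j • phiFun W j) <
      poleOrder (phiFun W t) := by
    have hbot : ⊥ < poleOrder (phiFun W t) := by
      rw [poleOrder_phiFun]
      exact WithBot.bot_lt_coe _
    refine poleOrder_sum_lt _ _ hbot fun j hj => ?_
    by_cases haj : a j = 0
    · simpa [haj, poleOrder_zero] using hbot
    · have hle : j ≤ t := hmax j (Finset.mem_filter.2 ⟨Finset.mem_univ j, haj⟩)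
      have hlt : (j : ℕ) < t := lt_of_le_of_ne (Fin.le_def.1 hle) fun h =>
        Finset.ne_of_mem_erase hj (Fin.ext h)
      refine (poleOrder_smul_le _ _).trans_lt ?_
      rw [poleOrder_phiFun, poleOrder_phiFun]
      norm_cast
      split_ifs <;> omega
  refine hrest.not_ge ?_
  have hphi : phiFun W t =
      (a t)⁻¹ • -(∑ j ∈ Finset.univ.erase t, a j • phiFun W j) := by
    rw [← eq_neg_of_add_eq_zero_left h0, smul_smul, inv_mul_cancel₀ hat, one_smul]
  conv_lhs => rw [hphi]
  refine (poleOrder_smul_le _ _).trans ?_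
  rw [poleOrder_neg]

/-- Evaluation of functions at an affine rational point. -/
noncomputable def evalPoint (P : {P : W.toAffine.Point // P ≠ .zero}) :
    W.toAffine.CoordinateRing →ₐ[F] F :=
  match P with
  | ⟨.zero, h⟩ => absurd rfl h
  | ⟨.some x y h, _⟩ => AdjoinRoot.liftAlgHom _ (aeval x) y <| by
      have := h.1
      rw [Affine.Equation, ← eval₂_evalRingHom] at this
      simpa [coe_aeval_eq_evalRingHom] using this

lemma evalPoint_xFun {x y : F} (h : W.toAffine.Nonsingular x y) (hP) :
    evalPoint ⟨.some x y h, hP⟩ (xFun W) = x := by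
  simp [evalPoint, xFun]

lemma evalPoint_yFun {x y : F} (h : W.toAffine.Nonsingular x y) (hP) :
    evalPoint ⟨.some x y h, hP⟩ (yFun W) = y := by
  simp [evalPoint, yFun]

lemma evalPoint_injective : Function.Injective (evalPoint (W := W)) := by
  rintro ⟨_ | ⟨x, y, h⟩, hP⟩ ⟨_ | ⟨x', y', h'⟩, hP'⟩ heq
  · exact absurd rfl hP
  · exact absurd rfl hP
  · exact absurd rfl hP'
  · have hx := DFunLike.congr_fun heq (xFun W)
    have hy := DFunLike.congr_fun heq (yFun W)
    rw [evalPoint_xFun, evalPoint_xFun] at hx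
    rw [evalPoint_yFun, evalPoint_yFun] at hy
    subst hx hy
    rfl

lemma evalPoint_combFun {k : ℕ} (a : Fin k → F) (P : {P : W.toAffine.Point // P ≠ .zero}) :
    evalPoint P (combFun W a) = ∑ j, a j * phiVec W k P j := by
  obtain ⟨_ | ⟨x, y, h⟩, hP⟩ := P
  · exact absurd rfl hP
  · rw [combFun, map_sum]
    refine Finset.sum_congr rfl fun j _ => ?_
    rw [map_smul, smul_eq_mul]
    congr 1
    simp only [phiFun, phiVec, psi]
    split_ifs <;> simp [evalPoint_xFun, evalPoint_yFun]

lemma sum_mul_phiVec_zero {k : ℕ} (a : Fin k → F) {t : Fin k} (ht : (t : ℕ) = k - 1) :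
    ∑ j, a j * phiVec W k .zero j = a t := by
  rw [Finset.sum_eq_single t]
  · simp [phiVec, ht]
  · intro j _ hj
    have : (j : ℕ) ≠ k - 1 := fun h => hj (Fin.ext (h.trans ht.symm))
    simp [phiVec, this]
  · simp

end Functions

/-! ### Elliptic codes -/

section EllipticCodes

variable {W : WeierstrassCurve F} {k n : ℕ} (e : Fin n ≃ W.toAffine.Point)

/-- The generator matrix of the elliptic code. -/
def genMatrix (W : WeierstrassCurve F) (k : ℕ) {n : ℕ} (e : Fin n ≃ W.toAffine.Point) :
    Matrix (Fin k) (Fin n) F :=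
  Matrix.of fun i j => phiVec W k (e j) i

lemma ellipticCode_eq_range :
    ellipticCode W k e = LinearMap.range (genMatrix W k e).vecMulLinear := by
  rw [range_vecMulLinear]
  rfl

/-- A codeword vanishing on `S` comes from a function vanishing at the affine points of `S`, and its
last coefficient is zero if `S` contains the point at infinity. With `T` the affine part of `S`, the
coefficients are supported in the first `|T| + k - |S|` places. -/
lemma exists_affine_zeros (hk : 1 ≤ k) (S : Finset (Fin n)) :
    ∃ T : Finset (Fin n), ∃ P : T → W.toAffine.CoordinateRing →ₐ[F] F, Function.Injective P ∧
      T.card ≤ S.card ∧ S.card ≤ T.card + 1 ∧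
      ∀ a : Fin k → F, (∀ j ∈ S, Matrix.vecMul a (genMatrix W k e) j = 0) →
        (∀ i, P i (combFun W a) = 0) ∧
          ∀ j : Fin k, T.card + k - S.card ≤ j → a j = 0 := by
  have hT : ∀ j ∈ S.erase (e.symm .zero), e j ≠ .zero := fun j hj h =>
    Finset.ne_of_mem_erase hj (by rw [← h, Equiv.symm_apply_apply])
  refine ⟨S.erase (e.symm .zero), fun j => evalPoint ⟨e j, hT j j.2⟩, ?_, ?_, ?_, ?_⟩
  · intro i j hij
    exact Subtype.ext (e.injective (congrArg Subtype.val (evalPoint_injective hij)))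
  · exact Finset.card_erase_le
  · have := Finset.pred_card_le_card_erase (s := S) (a := e.symm .zero)
    omega
  · intro a ha
    refine ⟨fun i => ?_, fun j hj => ?_⟩
    · rw [evalPoint_combFun]
      exact ha i (Finset.mem_of_mem_erase i.2)
    · by_cases h : e.symm .zero ∈ S
      · rw [Finset.card_erase_of_mem h] at hj
        have hpos := Finset.card_pos.2 ⟨_, h⟩
        have hzero : ∑ j, a j * phiVec W k (e (e.symm .zero)) j = 0 := ha _ h
        rw [Equiv.apply_symm_apply, sum_mul_phiVec_zero a (t := j) (by omega)] at hzero
        exact hzero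
      · rw [Finset.erase_eq_of_notMem h] at hj
        omega

lemma card_zeros_le (hk : 1 ≤ k) {a : Fin k → F} (ha0 : a ≠ 0) {S : Finset (Fin n)}
    (ha : ∀ j ∈ S, Matrix.vecMul a (genMatrix W k e) j = 0) : S.card ≤ k := by
  obtain ⟨T, P, hP, hTS, hST, hvan⟩ := exists_affine_zeros (k := k) e hk S
  obtain ⟨hz, hsupp⟩ := hvan a ha
  have h := (card_le_poleOrder hP (combFun_ne_zero ha0) hz).trans (poleOrder_combFun_le hsupp)
  rw [Fintype.card_coe] at h
  have : T.card ≤ T.card + k - S.card := by exact_mod_cast h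
  omega

lemma finrank_ker_restrictCode_le_one (hk : 3 ≤ k) {S : Finset (Fin n)} (hS : S.card = k - 1) :
    Module.finrank F (LinearMap.ker (restrictCode (genMatrix W k e) S)) ≤ 1 := by
  obtain ⟨T, P, hP, hTS, hST, hvan⟩ := exists_affine_zeros (k := k) e (by omega) S
  have hm : T.card + k - S.card = T.card + 1 := by omega
  rw [hm] at hvan
  let t : Fin k := ⟨T.card, by omega⟩
  have hvan' : ∀ a ∈ LinearMap.ker (restrictCode (genMatrix W k e) S),
      (∀ i, P i (combFun W a) = 0) ∧ ∀ j : Fin k, T.card + 1 ≤ j → a j = 0 := fun a ha =>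
    hvan a ((restrictCode_eq_zero_iff _).1 ha)
  -- A kernel vector without leading coefficient spans the kernel.
  have key : ∀ a ∈ LinearMap.ker (restrictCode (genMatrix W k e) S), a ≠ 0 → a t = 0 →
      ∀ b ∈ LinearMap.ker (restrictCode (genMatrix W k e) S), ∃ c : F, b = c • a := by
    intro a ha ha0 hat b hb
    obtain ⟨haz, has⟩ := hvan' a ha
    obtain ⟨hbz, hbs⟩ := hvan' b hb
    have has' : ∀ j : Fin k, T.card ≤ j → a j = 0 := fun j hj => by
      rcases hj.eq_or_lt with h | h
      · rw [← hat]
        exact congrArg a (Fin.ext h.symm)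
      · exact has j h
    obtain ⟨c, hc⟩ := exists_eq_smul_of_vanish hP (combFun_ne_zero ha0) haz hbz
      (by rw [Fintype.card_coe]; exact poleOrder_combFun_le has')
      (by rw [Fintype.card_coe]; exact poleOrder_combFun_le hbs)
    refine ⟨c, ?_⟩
    by_contra hne
    exact combFun_ne_zero (W := W) (sub_ne_zero.2 hne) (by rw [combFun_sub_smul, hc, sub_self])
  by_cases hex : ∃ a ∈ LinearMap.ker (restrictCode (genMatrix W k e) S), a ≠ 0 ∧ a t = 0
  · obtain ⟨a, ha, ha0, hat⟩ := hex
    refine finrank_le_one ⟨a, ha⟩ fun b => ?_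
    obtain ⟨c, hc⟩ := key a ha ha0 hat b b.2
    exact ⟨c, Subtype.ext hc.symm⟩
  · push Not at hex
    have hinj : Function.Injective ((LinearMap.proj t : (Fin k → F) →ₗ[F] F).comp
        (LinearMap.ker (restrictCode (genMatrix W k e) S)).subtype) := by
      rw [injective_iff_map_eq_zero]
      intro a ha
      by_contra ha0
      exact hex a a.2 (fun h => ha0 (Subtype.ext h)) ha
    simpa using LinearMap.finrank_le_finrank_of_injective hinj

end EllipticCodes

end Proof

/-- For an elliptic curve `E/F_q` with `n` rational points and
`3 ≤ k ≤ n - 1`, the `k`-elliptic code associated to `E` has dimension `k`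
(and length `n`) and is either near-MDS or MDS. -/
theorem statement0 (W : WeierstrassCurve F) [W.IsElliptic] {n : ℕ}
    (hn : n = Nat.card W.toAffine.Point) (e : Fin n ≃ W.toAffine.Point)
    {k : ℕ} (hk3 : 3 ≤ k) (hkn : k ≤ n - 1) :
    Module.finrank F (ellipticCode W k e) = k ∧
      (IsNMDS (ellipticCode W k e) ∨ IsMDS (ellipticCode W k e)) := by
  rw [ellipticCode_eq_range]
  exact isNMDS_or_isMDS_of_generator (genMatrix W k e) (by omega) (by omega)
    (fun a ha0 S ha => card_zeros_le e (by omega) ha0 ha)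
    fun S hS => finrank_ker_restrictCode_le_one e hk3 hS

end NMDS
end

section
/- Let E be an elliptic curve over F_q with n = #E(F_q) rational points and let 3 ≤ k ≤ n−1. Then any k−1 of the points φ_k(P), P ∈ E(F_q), are linearly independent in P^{k−1}(F_q) (i.e., any k−1 distinct columns of G_k(E) are linearly independent over F_q); consequently, the dual of the k-elliptic code associated to E has dimension n−k and minimum distance at least k. -/
set_option linter.unusedSectionVars false

namespace NMDS

open WeierstrassCurve

variable {F : Type} [Field F] [Fintype F] [DecidableEq F]

section CoordinateRing

open Polynomial WeierstrassCurve.Affine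

variable {K : Type*} [Field K] {W : WeierstrassCurve.Affine K}

/-- Finitely many distinct `K`-algebra homomorphisms to `K` can be interpolated. -/
lemma algHom_pi_surjective {R ι : Type*} [CommRing R] [Algebra K R] [Finite ι]
    {φ : ι → R →ₐ[K] K} (hφ : Function.Injective φ) :
    Function.Surjective (LinearMap.pi fun i => (φ i).toLinearMap) := by
  classical
  have := Fintype.ofFinite ι
  have separate (i j : ι) : ∃ r : R, i ≠ j → φ i r = 1 ∧ φ j r = 0 := by
    by_cases hij : i = j
    · exact ⟨0, fun h => absurd hij h⟩
    obtain ⟨t, ht⟩ : ∃ t, φ i t ≠ φ j t := by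
      by_contra! h
      exact hij (hφ (AlgHom.ext h))
    refine ⟨algebraMap K R (φ i t - φ j t)⁻¹ * (t - algebraMap K R (φ j t)), fun _ => ?_⟩
    simp [inv_mul_cancel₀ (sub_ne_zero.mpr ht)]
  choose r hr using separate
  intro v
  refine ⟨∑ i, v i • ∏ j ∈ Finset.univ.erase i, r i j, funext fun l => ?_⟩
  simp only [LinearMap.pi_apply, AlgHom.toLinearMap_apply, map_sum, map_smul, map_prod,
    smul_eq_mul]
  rw [Finset.sum_eq_single l]
  · rw [Finset.prod_eq_one fun j hj => (hr l j (Finset.ne_of_mem_erase hj).symm).1, mul_one]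
  · intro i _ hil
    rw [Finset.prod_eq_zero (Finset.mem_erase.mpr ⟨hil.symm, Finset.mem_univ l⟩) (hr i l hil).2,
      mul_zero]
  · simp

instance : Module.Finite K[X] W.CoordinateRing := .of_basis (CoordinateRing.basis W)

lemma finiteDimensional_quotient_span_singleton {g : W.CoordinateRing} (hg : g ≠ 0) :
    FiniteDimensional K (W.CoordinateRing ⧸ Ideal.span {g}) :=
  have hI : Ideal.span {g} ≠ ⊥ := Ideal.span_singleton_eq_bot.not.2 hg
  Module.Finite.equiv (Ideal.quotientEquivDirectSum K (CoordinateRing.basis W) hI).symm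

section Vanishing

variable {ι : Type*} [Fintype ι] {φ : ι → W.CoordinateRing →ₐ[K] K} {g : W.CoordinateRing}

/-- Evaluation of the residue classes modulo a function at some of its zeros. -/
noncomputable def quotientEval (hz : ∀ i, φ i g = 0) :
    (W.CoordinateRing ⧸ Ideal.span {g}) →ₗ[K] (ι → K) :=
  ((Ideal.span {g}).restrictScalars K).liftQ (LinearMap.pi fun i => (φ i).toLinearMap) <| by
    intro f hf
    obtain ⟨h, rfl⟩ := Ideal.mem_span_singleton.mp hf
    ext i
    simp [hz i]

lemma quotientEval_surjective (hφ : Function.Injective φ) (hz : ∀ i, φ i g = 0) :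
    Function.Surjective (quotientEval hz) := fun v => by
  obtain ⟨f, hf⟩ := algHom_pi_surjective hφ v
  exact ⟨Ideal.Quotient.mk _ f, hf⟩

/-- A nonzero function has at most as many zeros as the degree of its norm. -/
lemma card_le_natDegree_norm (hφ : Function.Injective φ) (hg : g ≠ 0) (hz : ∀ i, φ i g = 0) :
    Fintype.card ι ≤ (Algebra.norm K[X] g).natDegree := by
  have := finiteDimensional_quotient_span_singleton hg
  rw [← finrank_quotient_span_eq_natDegree_norm (CoordinateRing.basis W) hg,
    ← Module.finrank_fintype_fun_eq_card K]
  exact LinearMap.finrank_le_finrank_of_surjective (quotientEval_surjective hφ hz)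

/-- A function with the maximal number of zeros divides every function with the same zeros. -/
lemma dvd_of_natDegree_norm_le_card (hφ : Function.Injective φ) (hg : g ≠ 0)
    (hz : ∀ i, φ i g = 0) (hd : (Algebra.norm K[X] g).natDegree ≤ Fintype.card ι)
    {f : W.CoordinateRing} (hf : ∀ i, φ i f = 0) : g ∣ f := by
  have := finiteDimensional_quotient_span_singleton hg
  have hrank : Module.finrank K (W.CoordinateRing ⧸ Ideal.span {g}) =
      Module.finrank K (ι → K) := by
    rw [finrank_quotient_span_eq_natDegree_norm (CoordinateRing.basis W) hg,
      Module.finrank_fintype_fun_eq_card]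
    exact hd.antisymm (card_le_natDegree_norm hφ hg hz)
  have hinj := (LinearMap.injective_iff_surjective_of_finrank_eq_finrank hrank).mpr
    (quotientEval_surjective hφ hz)
  rw [← Ideal.mem_span_singleton, ← Ideal.Quotient.eq_zero_iff_mem]
  exact hinj ((funext hf : quotientEval hz (Ideal.Quotient.mk _ f) = 0).trans (map_zero _).symm)

end Vanishing

lemma degree_norm_add_le (f g : W.CoordinateRing) :
    (Algebra.norm K[X] (f + g)).degree ≤
      max (Algebra.norm K[X] f).degree (Algebra.norm K[X] g).degree := by
  obtain ⟨p, q, rfl⟩ := CoordinateRing.exists_smul_basis_eq f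
  obtain ⟨r, s, rfl⟩ := CoordinateRing.exists_smul_basis_eq g
  rw [add_add_add_comm, ← add_smul, ← add_smul]
  simp only [CoordinateRing.degree_norm_smul_basis]
  refine max_le ?_ ?_
  · rcases le_max_iff.mp (degree_add_le p r) with h | h <;> grw [h] <;> simp
  · rcases le_max_iff.mp (degree_add_le q s) with h | h <;> grw [h] <;> simp

lemma degree_norm_C {c : K} (hc : c ≠ 0) :
    (Algebra.norm K[X] (algebraMap K W.CoordinateRing c)).degree = 0 := by
  have := CoordinateRing.degree_norm_smul_basis (W' := W) (C c) 0
  rw [zero_smul, add_zero, ← Algebra.algebraMap_eq_smul_one, ← Polynomial.algebraMap_eq,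
    ← IsScalarTower.algebraMap_apply] at this
  rw [this]
  simp [hc]

lemma degree_norm_X : (Algebra.norm K[X] (CoordinateRing.mk W (C X))).degree = 2 := by
  have := CoordinateRing.degree_norm_smul_basis (W' := W) X 0
  rw [zero_smul, add_zero, CoordinateRing.smul, mul_one] at this
  rw [this]
  simp

lemma degree_norm_Y : (Algebra.norm K[X] (CoordinateRing.mk W X)).degree = 3 := by
  have := CoordinateRing.degree_norm_smul_basis (W' := W) 0 1
  rw [zero_smul, zero_add, one_smul] at this
  rw [this]
  simp

lemma exists_eq_algebraMap_of_degree_norm_le {f : W.CoordinateRing}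
    (hf : (Algebra.norm K[X] f).degree ≤ 1) : ∃ c : K, f = algebraMap K W.CoordinateRing c := by
  obtain ⟨p, q, rfl⟩ := CoordinateRing.exists_smul_basis_eq f
  rw [CoordinateRing.degree_norm_smul_basis, max_le_iff] at hf
  obtain ⟨hp, hq⟩ := hf
  have hq0 : q = 0 := by
    by_contra h
    rw [degree_eq_natDegree h] at hq
    norm_cast at hq
  have hp0 : p.degree ≤ 0 := by
    by_cases h : p = 0
    · simp [h]
    rw [degree_eq_natDegree h, nsmul_eq_mul] at hp
    rw [degree_eq_natDegree h]
    norm_cast at hp ⊢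
    omega
  refine ⟨p.coeff 0, ?_⟩
  rw [hq0, zero_smul, add_zero, eq_C_of_degree_le_zero hp0, ← Algebra.algebraMap_eq_smul_one,
    ← Polynomial.algebraMap_eq, ← IsScalarTower.algebraMap_apply]
  simp

/-- The space `L(d · ∞)` of functions with a pole of order at most `d` at infinity. -/
noncomputable def poleLE (W : WeierstrassCurve.Affine K) (d : ℕ) :
    Submodule K W.CoordinateRing where
  carrier := {f | (Algebra.norm K[X] f).degree ≤ d}
  add_mem' hf hg := (degree_norm_add_le _ _).trans (max_le hf hg)
  zero_mem' := by simp [Algebra.norm_zero]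
  smul_mem' c f hf := by
    rcases eq_or_ne c 0 with rfl | hc
    · simp [Algebra.norm_zero]
    · simpa [Algebra.smul_def, degree_norm_C hc] using hf

lemma mem_poleLE {d : ℕ} {f : W.CoordinateRing} :
    f ∈ poleLE W d ↔ (Algebra.norm K[X] f).degree ≤ d := Iff.rfl

/-- Functions of pole order at most `m + 1` with `m` common zeros are proportional. -/
lemma exists_eq_smul_of_mem_poleLE {ι : Type*} [Fintype ι] {φ : ι → W.CoordinateRing →ₐ[K] K}
    (hφ : Function.Injective φ) {f g : W.CoordinateRing} (hg : g ≠ 0)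
    (hgz : ∀ i, φ i g = 0) (hfz : ∀ i, φ i f = 0) (hgd : g ∈ poleLE W (Fintype.card ι))
    (hfd : f ∈ poleLE W (Fintype.card ι + 1)) : ∃ c : K, f = c • g := by
  rw [mem_poleLE] at hgd hfd
  obtain ⟨h, rfl⟩ := dvd_of_natDegree_norm_le_card hφ hg hgz
    (natDegree_le_of_degree_le hgd) hfz
  have hcard := card_le_natDegree_norm hφ hg hgz
  have hnorm : Algebra.norm K[X] g ≠ 0 := Algebra.norm_ne_zero_iff.mpr hg
  have hdeg : (Algebra.norm K[X] g).degree = Fintype.card ι :=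
    hgd.antisymm ((Nat.cast_le.mpr hcard).trans_eq (degree_eq_natDegree hnorm).symm)
  obtain ⟨c, rfl⟩ := exists_eq_algebraMap_of_degree_norm_le (f := h) <| by
    rw [map_mul, degree_mul, hdeg, Nat.cast_add, Nat.cast_one] at hfd
    exact (WithBot.add_le_add_iff_left (WithBot.coe_ne_bot)).mp hfd
  exact ⟨c, by rw [Algebra.smul_def, mul_comm]⟩

/-- A function with more zeros than its pole order vanishes. -/
lemma eq_zero_of_mem_poleLE {ι : Type*} [Fintype ι] {φ : ι → W.CoordinateRing →ₐ[K] K}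
    (hφ : Function.Injective φ) {f : W.CoordinateRing} {d : ℕ} (hfz : ∀ i, φ i f = 0)
    (hfd : f ∈ poleLE W d) (hd : d < Fintype.card ι) : f = 0 := by
  by_contra hf
  exact absurd (card_le_natDegree_norm hφ hf hfz)
    ((natDegree_le_of_degree_le hfd).trans_lt hd).not_ge

/-- The monomial function giving the coordinate of index `j` of `φ_k`. -/
noncomputable def coordFun (W : WeierstrassCurve.Affine K) (j : ℕ) : W.CoordinateRing :=
  if j = 0 then 1
  else if (j + 1) % 3 = 0 then CoordinateRing.mk W X ^ ((j + 1) / 3)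
  else if (j + 1) % 3 = 2 then
    CoordinateRing.mk W (C X) * CoordinateRing.mk W X ^ ((j + 1) / 3)
  else CoordinateRing.mk W (C X) ^ 2 * CoordinateRing.mk W X ^ ((j + 1 - 4) / 3)

lemma degree_norm_coordFun (j : ℕ) :
    (Algebra.norm K[X] (coordFun W j)).degree = if j = 0 then 0 else ((j + 1 : ℕ) : WithBot ℕ) := by
  unfold coordFun
  split_ifs with h₀ h₁ h₂
  all_goals
    simp only [map_one, map_mul, map_pow, degree_one, degree_mul, degree_pow, degree_norm_X,
      degree_norm_Y]
  all_goals
    simp only [nsmul_eq_mul]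
    norm_cast
    omega

lemma coordFun_mem_poleLE {j d : ℕ} (h : j < d) : coordFun W j ∈ poleLE W d := by
  rw [mem_poleLE, degree_norm_coordFun]
  split_ifs
  · exact Nat.cast_nonneg d
  · exact Nat.cast_le.mpr h

lemma sum_smul_coordFun_mem_poleLE {k d : ℕ} {a : Fin k → K} (h : ∀ j : Fin k, d ≤ j → a j = 0) :
    ∑ j, a j • coordFun W j ∈ poleLE W d := by
  refine Submodule.sum_mem _ fun j _ => ?_
  by_cases hj : (j : ℕ) < d
  · exact Submodule.smul_mem _ _ (coordFun_mem_poleLE hj)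
  · simp [h j (not_lt.mp hj)]

lemma sum_smul_coordFun_eq_zero {k : ℕ} {a : Fin k → K}
    (h : ∑ j, a j • coordFun W j = 0) : a = 0 := by
  induction k with
  | zero => exact Subsingleton.elim _ _
  | succ k ih =>
    rw [Fin.sum_univ_castSucc] at h
    have hlast : a (Fin.last k) = 0 := by
      by_contra ha
      have hmem : coordFun W k ∈ Submodule.span K {∑ j : Fin k, a j.castSucc • coordFun W j} := by
        refine Submodule.mem_span_singleton.mpr ⟨-(a (Fin.last k))⁻¹, ?_⟩
        have hsum : ∑ j : Fin k, a j.castSucc • coordFun W j =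
            -(a (Fin.last k) • coordFun W k) := eq_neg_of_add_eq_zero_left h
        simp [hsum, smul_smul, inv_mul_cancel₀ ha]
      rcases k.eq_zero_or_pos with rfl | hk
      · simp [coordFun] at hmem
      · have hle : coordFun W k ∈ poleLE W k :=
          (Submodule.span_singleton_le_iff_mem _ _).mpr
            (sum_smul_coordFun_mem_poleLE fun j hj => absurd j.2 hj.not_gt) hmem
        rw [mem_poleLE, degree_norm_coordFun, if_neg hk.ne', Nat.cast_le] at hle
        omega
    have hinit : (fun j : Fin k => a j.castSucc) = 0 := ih (by simpa [hlast] using h)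
    ext j
    refine Fin.lastCases hlast (fun i => congrFun hinit i) j

/-- A space of coefficient vectors of functions of pole order at most `m + 1` with `m` common zeros
has dimension at most one. -/
lemma finrank_le_one_of_vanishing {ι : Type*} [Fintype ι] {φ : ι → W.CoordinateRing →ₐ[K] K}
    (hφ : Function.Injective φ) {k : ℕ} (hk : Fintype.card ι < k) (A : Submodule K (Fin k → K))
    (hz : ∀ a ∈ A, ∀ i, φ i (∑ j, a j • coordFun W j) = 0)
    (hd : ∀ a ∈ A, ∀ j : Fin k, Fintype.card ι + 1 ≤ j → a j = 0) :
    Module.finrank K A ≤ 1 := by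
  by_contra! hA
  let ℓ : A →ₗ[K] K := LinearMap.proj ⟨Fintype.card ι, hk⟩ ∘ₗ A.subtype
  have hℓ : 0 < Module.finrank K (LinearMap.ker ℓ) := by
    have h₁ := LinearMap.finrank_range_add_finrank_ker ℓ
    have h₂ := (LinearMap.range ℓ).finrank_le
    rw [Module.finrank_self] at h₂
    omega
  have : Nontrivial (LinearMap.ker ℓ) := Module.nontrivial_of_finrank_pos hℓ
  obtain ⟨⟨⟨a, haA⟩, haℓ⟩, ha⟩ := exists_ne (0 : LinearMap.ker ℓ)
  have ha0 : a ≠ 0 := fun h => ha (Subtype.ext (Subtype.ext h))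
  refine hA.not_ge (finrank_le_one (⟨a, haA⟩ : A) fun ⟨b, hbA⟩ => ?_)
  have hda (j : Fin k) (hj : Fintype.card ι ≤ j) : a j = 0 := by
    rcases hj.eq_or_lt with hj | hj
    · rw [← show (⟨Fintype.card ι, hk⟩ : Fin k) = j from Fin.ext hj]
      exact haℓ
    · exact hd a haA j hj
  obtain ⟨c, hc⟩ := exists_eq_smul_of_mem_poleLE hφ (mt sum_smul_coordFun_eq_zero ha0) (hz a haA)
    (hz b hbA) (sum_smul_coordFun_mem_poleLE hda)
    (sum_smul_coordFun_mem_poleLE (hd b hbA))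
  refine ⟨c, Subtype.ext (sub_eq_zero.mp (sum_smul_coordFun_eq_zero (W := W) ?_))⟩
  simp [sub_smul, Finset.sum_sub_distrib, hc, Finset.smul_sum, smul_smul]

/-- Evaluation of functions at an affine point of the curve. -/
noncomputable def evalAt {x y : K} (h : W.Equation x y) : W.CoordinateRing →ₐ[K] K :=
  { AdjoinRoot.evalEval h with
    commutes' := fun c => (AdjoinRoot.evalEval_mk h (C (C c))).trans (by rw [evalEval_C, eval_C, Algebra.algebraMap_self_apply]) }

lemma evalAt_X {x y : K} (h : W.Equation x y) : evalAt h (CoordinateRing.mk W (C X)) = x :=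
  (AdjoinRoot.evalEval_mk h (C X)).trans (by rw [evalEval_C, eval_X])

lemma evalAt_Y {x y : K} (h : W.Equation x y) : evalAt h (CoordinateRing.mk W X) = y :=
  (AdjoinRoot.evalEval_mk h X).trans (by simp)

end CoordinateRing

section EllipticCode

/-- Evaluation of functions at a point other than the one at infinity. -/
noncomputable def pointEval (W : WeierstrassCurve F) :
    (P : W.toAffine.Point) → P ≠ .zero → W.toAffine.CoordinateRing →ₐ[F] F
  | .zero, h => absurd rfl h
  | .some _ _ h, _ => evalAt h.1

variable {W : WeierstrassCurve F}

lemma pointEval_injective {P Q : W.toAffine.Point} {hP : P ≠ .zero} {hQ : Q ≠ .zero}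
    (h : pointEval W P hP = pointEval W Q hQ) : P = Q := by
  rcases P with _ | ⟨x, y, hxy⟩
  · exact absurd rfl hP
  rcases Q with _ | ⟨x', y', hxy'⟩
  · exact absurd rfl hQ
  have hx : x = x' := by
    simpa only [pointEval, evalAt_X] using DFunLike.congr_fun h
      (Affine.CoordinateRing.mk W.toAffine (Polynomial.C Polynomial.X))
  have hy : y = y' := by
    simpa only [pointEval, evalAt_Y] using DFunLike.congr_fun h
      (Affine.CoordinateRing.mk W.toAffine Polynomial.X)
  subst hx hy
  rfl

lemma pointEval_sum_smul_coordFun {k : ℕ} (a : Fin k → F) {P : W.toAffine.Point}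
    (hP : P ≠ .zero) :
    pointEval W P hP (∑ j, a j • coordFun W.toAffine j) = a ⬝ᵥ phiVec W k P := by
  rcases P with _ | ⟨x, y, hxy⟩
  · exact absurd rfl hP
  simp only [pointEval, map_sum, map_smul, smul_eq_mul, dotProduct]
  refine Finset.sum_congr rfl fun j _ => ?_
  simp only [phiVec, psi, coordFun]
  split_ifs <;> simp only [map_one, map_mul, map_pow, evalAt_X, evalAt_Y]

lemma dotProduct_phiVec_zero {k : ℕ} (hk : 0 < k) (a : Fin k → F) :
    a ⬝ᵥ phiVec W k .zero = a ⟨k - 1, by omega⟩ := by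
  rw [dotProduct, Finset.sum_eq_single ⟨k - 1, by omega⟩]
  · simp [phiVec]
  · intro j _ hj
    simp [phiVec, show (j : ℕ) ≠ k - 1 from fun h => hj (Fin.ext h)]
  · simp

/-- The hyperplanes through `k - 1` points of the curve form a space of dimension at most one. -/
lemma finrank_ker_mulVecLin_le_one {k : ℕ} (hk : 3 ≤ k) {s : Finset W.toAffine.Point}
    (hs : s.card = k - 1) :
    Module.finrank F (LinearMap.ker
      (Matrix.of fun P : s => phiVec W k (P : W.toAffine.Point)).mulVecLin) ≤ 1 := by
  have hmem {a : Fin k → F} (ha : a ∈ LinearMap.ker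
      (Matrix.of fun P : s => phiVec W k (P : W.toAffine.Point)).mulVecLin)
      {P : W.toAffine.Point} (hP : P ∈ s) : a ⬝ᵥ phiVec W k P = 0 := by
    rw [dotProduct_comm]
    exact congrFun (LinearMap.mem_ker.mp ha) ⟨P, hP⟩
  have hcard : Fintype.card (s.erase .zero) = (s.erase .zero).card := Fintype.card_coe _
  have hlt := Finset.card_erase_le (s := s) (a := Affine.Point.zero)
  refine finrank_le_one_of_vanishing (W := W.toAffine)
    (φ := fun P : s.erase .zero => pointEval W P (Finset.ne_of_mem_erase P.2))
    (fun P Q h => Subtype.ext (pointEval_injective h)) (by omega) _ (fun a ha P => ?_)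
    fun a ha j hj => ?_
  · rw [pointEval_sum_smul_coordFun]
    exact hmem ha (Finset.mem_of_mem_erase P.2)
  · by_cases hzero : Affine.Point.zero ∈ s
    · rw [hcard, Finset.card_erase_of_mem hzero] at hj
      rw [show j = ⟨k - 1, by omega⟩ from Fin.ext (by dsimp only; omega),
        ← dotProduct_phiVec_zero (W := W) (by omega) a]
      exact hmem ha hzero
    · rw [hcard, Finset.erase_eq_of_notMem hzero] at hj
      omega

lemma linearIndependent_phiVec {k : ℕ} (hk : 3 ≤ k) {s : Finset W.toAffine.Point}
    (hs : s.card = k - 1) :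
    LinearIndependent F fun P : s => phiVec W k (P : W.toAffine.Point) := by
  rw [linearIndependent_iff_card_le_finrank_span]
  let M := Matrix.of fun P : s => phiVec W k (P : W.toAffine.Point)
  have hker : Module.finrank F (LinearMap.ker M.mulVecLin) ≤ 1 :=
    finrank_ker_mulVecLin_le_one hk hs
  have hrank := LinearMap.finrank_range_add_finrank_ker M.mulVecLin
  rw [Module.finrank_fin_fun] at hrank
  have hrow : M.rank = Set.finrank F (Set.range fun P : s => phiVec W k P) :=
    M.rank_eq_finrank_span_row
  rw [← hrow, Fintype.card_coe, hs, Matrix.rank]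
  omega

/-- The matrix `G_k(E)` whose columns are the coordinate vectors of the points `φ_k(P)`. -/
def generatorMatrix (W : WeierstrassCurve F) (k : ℕ) {n : ℕ} (e : Fin n ≃ W.toAffine.Point) :
    Matrix (Fin k) (Fin n) F :=
  Matrix.of fun i j => phiVec W k (e j) i

lemma dualCode_ellipticCode {k n : ℕ} (e : Fin n ≃ W.toAffine.Point) :
    dualCode (ellipticCode W k e) = LinearMap.ker (generatorMatrix W k e).mulVecLin := by
  ext x
  simp only [dualCode, Submodule.mem_iInf, LinearMap.mem_ker]
  constructor
  · intro h
    ext i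
    exact (dotProduct_comm _ x).trans (h _ (Submodule.subset_span ⟨i, rfl⟩))
  · intro h y hy
    change x ⬝ᵥ y = 0
    induction hy using Submodule.span_induction with
    | mem y hy =>
      obtain ⟨i, rfl⟩ := hy
      exact (dotProduct_comm _ _).trans (congrFun h i)
    | zero => exact dotProduct_zero x
    | add y z _ _ hy hz => rw [dotProduct_add, hy, hz, add_zero]
    | smul c y _ hy => rw [dotProduct_smul, hy, smul_zero]

lemma linearIndependent_generatorMatrix {k n : ℕ} (hk : 0 < k) (hkn : k < n)
    (e : Fin n ≃ W.toAffine.Point) : LinearIndependent F (generatorMatrix W k e).row := by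
  rw [Fintype.linearIndependent_iff]
  intro a ha
  have hmem (P : W.toAffine.Point) : a ⬝ᵥ phiVec W k P = 0 := by
    simpa [generatorMatrix, Matrix.row, dotProduct] using congrFun ha (e.symm P)
  have : Fintype W.toAffine.Point := .ofEquiv _ e
  have hcard : Fintype.card {P : W.toAffine.Point // P ≠ .zero} = n - 1 := by
    rw [Fintype.card_subtype_compl, Fintype.card_subtype_eq, ← Fintype.card_congr e,
      Fintype.card_fin]
  refine congrFun (sum_smul_coordFun_eq_zero (eq_zero_of_mem_poleLE (W := W.toAffine) (d := k - 1)
    (φ := fun P : {P : W.toAffine.Point // P ≠ .zero} => pointEval W P P.2)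
    (fun P Q h => Subtype.ext (pointEval_injective h)) (fun P => ?_) ?_ (by omega)))
  · rw [pointEval_sum_smul_coordFun, hmem]
  · refine sum_smul_coordFun_mem_poleLE fun j hj => ?_
    rw [show j = ⟨k - 1, by omega⟩ from Fin.ext (by dsimp only; omega),
      ← dotProduct_phiVec_zero (W := W) hk a, hmem]

lemma finrank_dualCode_ellipticCode {k n : ℕ} (hk : 0 < k) (hkn : k < n)
    (e : Fin n ≃ W.toAffine.Point) :
    Module.finrank F (dualCode (ellipticCode W k e)) = n - k := by
  have hrank : (generatorMatrix W k e).rank = k := by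
    rw [(linearIndependent_generatorMatrix hk hkn e).rank_matrix, Fintype.card_fin]
  have h := LinearMap.finrank_range_add_finrank_ker (generatorMatrix W k e).mulVecLin
  rw [Module.finrank_fin_fun] at h
  rw [Matrix.rank] at hrank
  rw [dualCode_ellipticCode]
  omega

lemma le_hammingNorm_of_mem_dualCode {k n : ℕ} (hk : 3 ≤ k) (hkn : k < n)
    (e : Fin n ≃ W.toAffine.Point) {x : Fin n → F} (hx : x ∈ dualCode (ellipticCode W k e))
    (hx0 : x ≠ 0) : k ≤ hammingNorm x := by
  by_contra! hlt
  obtain ⟨t, hsub, ht⟩ := Finset.exists_superset_card_eq (n := k - 1)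
    (s := Finset.univ.filter fun i => x i ≠ 0) (Nat.le_sub_one_of_lt hlt) (by simp; omega)
  have hsupp {j : Fin n} (hj : j ∉ t) : x j = 0 := by
    by_contra h
    exact hj (hsub (by simp [h]))
  have hli := linearIndependent_phiVec hk (s := t.map e.toEmbedding) (by rw [Finset.card_map, ht])
  refine hx0 (funext fun j => ?_)
  by_cases hj : j ∈ t
  · have hzero := linearIndepOn_finset_iff.mp hli (fun P => x (e.symm P)) ?_ (e j)
      (Finset.mem_map_of_mem _ hj)
    · simpa using hzero
    rw [dualCode_ellipticCode] at hx
    ext i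
    rw [Finset.sum_map, Finset.sum_subset (Finset.subset_univ t) fun j _ hj => by simp [hsupp hj]]
    simpa [generatorMatrix, Matrix.mulVec, dotProduct, mul_comm] using
      congrFun (LinearMap.mem_ker.mp hx) i
  · exact hsupp hj

end EllipticCode

/-- For `3 ≤ k ≤ n - 1`, any `k - 1` of the points `φ_k(P)`, `P ∈ E(F_q)`,
are linearly independent (any `k - 1` distinct columns of `G_k(E)` are linearly independent);
consequently the dual of the `k`-elliptic code has dimension `n - k` and minimum distance
at least `k`. -/
theorem statement3 (W : WeierstrassCurve F) [W.IsElliptic] {n : ℕ}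
    (hn : n = Nat.card W.toAffine.Point) (e : Fin n ≃ W.toAffine.Point)
    {k : ℕ} (hk3 : 3 ≤ k) (hkn : k ≤ n - 1) :
    (∀ s : Finset W.toAffine.Point, s.card = k - 1 →
        LinearIndependent F fun P : s => phiVec W k (P : W.toAffine.Point)) ∧
      Module.finrank F (dualCode (ellipticCode W k e)) = n - k ∧
      k ≤ minDist (dualCode (ellipticCode W k e)) := by
  have hlt : k < n := by omega
  have hrank := finrank_dualCode_ellipticCode (by omega) hlt e
  refine ⟨fun s hs => linearIndependent_phiVec hk3 hs, hrank, le_csInf ?_ ?_⟩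
  · have : Nontrivial (dualCode (ellipticCode W k e)) :=
      Module.nontrivial_of_finrank_pos (R := F) (by omega)
    obtain ⟨x, hx⟩ := exists_ne (0 : dualCode (ellipticCode W k e))
    exact ⟨_, x, x.2, fun h => hx (Subtype.ext h), rfl⟩
  · rintro _ ⟨x, hx, hx0, rfl⟩
    exact le_hammingNorm_of_mem_dualCode hk3 hlt e hx hx0

end NMDS
end

section
/- Let q be odd and let E be the elliptic cubic curve in P²(F_q) with affine canonical equation Y² = X³ + aX² + bX + c (a, b, c ∈ F_q, the cubic being nonsingular). For every point P ∈ P²(F_q) not on E, there are at most 6 tangent lines of E passing through P. -/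
set_option linter.unusedSectionVars false

namespace NMDS

open WeierstrassCurve

variable {F : Type} [Field F] [Fintype F] [DecidableEq F]

lemma two_ne_zero_of_odd_card (hodd : Odd (Fintype.card F)) : (2 : F) ≠ 0 := by
  intro h
  have hchar : ringChar F = 2 := CharP.ringChar_of_prime_eq_zero Nat.prime_two (by exact_mod_cast h)
  have := FiniteField.even_card_iff_char_two.mp hchar
  rcases hodd with ⟨k, hk⟩
  omega

/-- The zeros in `F` of a nonzero polynomial with coefficients `c 0, …, c n` number at most `n`. -/
lemma ncard_zeros_le {n : ℕ} (c : Fin (n + 1) → F) (hc : c ≠ 0) :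
    {t : F | ∑ i, c i * t ^ (i : ℕ) = 0}.ncard ≤ n := by
  classical
  let D : Polynomial F := ∑ i, Polynomial.C (c i) * Polynomial.X ^ (i : ℕ)
  have hcoeff (i : Fin (n + 1)) : D.coeff i = c i := by
    simp [D, Polynomial.coeff_X_pow, Fin.val_inj]
  have hD : D ≠ 0 := fun h => hc (funext fun i => by simp [← hcoeff i, h])
  have hdeg : D.natDegree ≤ n := Polynomial.natDegree_sum_le_of_forall_le _ _ fun i _ =>
    (Polynomial.natDegree_C_mul_X_pow_le _ _).trans (by omega)
  have hsub : {t : F | ∑ i, c i * t ^ (i : ℕ) = 0} = (D.roots.toFinset : Set F) := by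
    ext t
    simp [D, hD, Polynomial.eval_finsetSum]
  rw [hsub, Set.ncard_coe_finset]
  exact (Multiset.toFinset_card_le _).trans ((Polynomial.card_roots' D).trans hdeg)

lemma eq_of_rep_eq_mul {L M : Projectivization F (Fin 3 → F)} (c : F)
    (h0 : L.rep 0 = c * M.rep 0) (h1 : L.rep 1 = c * M.rep 1) (h2 : L.rep 2 = c * M.rep 2) :
    L = M := by
  rw [← L.mk_rep, ← M.mk_rep, Projectivization.mk_eq_mk_iff']
  refine ⟨c, ?_⟩
  ext i
  fin_cases i <;> simp [h0, h1, h2]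

/-- Two lines with equations `y = m x + k` and the same `m`, `k` coincide. -/
lemma eq_of_slope_eq_of_intercept_eq {L M : Projectivization F (Fin 3 → F)}
    (hL : L.rep 1 ≠ 0) (hM : M.rep 1 ≠ 0)
    (hm : -L.rep 0 / L.rep 1 = -M.rep 0 / M.rep 1)
    (hk : -L.rep 2 / L.rep 1 = -M.rep 2 / M.rep 1) : L = M := by
  field_simp at hm hk
  refine eq_of_rep_eq_mul (L.rep 1 / M.rep 1) ?_ ?_ ?_ <;> field_simp
  · linear_combination -hm
  · linear_combination -hk

/-- The discriminant of the monic cubic `x³ + r x² + s x + u`. -/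
def monicCubicDisc {R : Type*} [CommRing R] (r s u : R) : R :=
  r ^ 2 * s ^ 2 - 4 * s ^ 3 - 4 * r ^ 3 * u - 27 * u ^ 2 + 18 * r * s * u

lemma monicCubicDisc_eq_zero {R : Type*} [CommRing R] {r s u x : R}
    (h : x ^ 3 + r * x ^ 2 + s * x + u = 0) (h' : 3 * x ^ 2 + 2 * r * x + s = 0) :
    monicCubicDisc r s u = 0 := by
  obtain rfl : s = -(3 * x ^ 2 + 2 * r * x) := by linear_combination h'
  obtain rfl : u = 2 * x ^ 3 + r * x ^ 2 := by linear_combination h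
  rw [monicCubicDisc]
  ring

lemma Δ_eq_disc {W : WeierstrassCurve F} (ha₁ : W.a₁ = 0) (ha₃ : W.a₃ = 0) :
    W.Δ = 16 * monicCubicDisc W.a₂ W.a₄ W.a₆ := by
  simp only [WeierstrassCurve.Δ, WeierstrassCurve.b₂, WeierstrassCurve.b₄, WeierstrassCurve.b₆,
    WeierstrassCurve.b₈, ha₁, ha₃, monicCubicDisc]
  ring

lemma disc_ne_zero {W : WeierstrassCurve F} [W.IsElliptic] (ha₁ : W.a₁ = 0) (ha₃ : W.a₃ = 0) :
    monicCubicDisc W.a₂ W.a₄ W.a₆ ≠ 0 := fun h =>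
  W.isUnit_Δ.ne_zero (by rw [Δ_eq_disc ha₁ ha₃, h, mul_zero])

/-- A contact point of a tangent line other than `z = 0` is affine. -/
lemma IsTangentLine.exists_affine {W : WeierstrassCurve F} (ha₁ : W.a₁ = 0) (ha₃ : W.a₃ = 0)
    {l : Fin 3 → F} (h : IsTangentLine W l) (hl : l 0 ≠ 0 ∨ l 1 ≠ 0) :
    ∃ x y t : AlgebraicClosure F,
      y ^ 2 = x ^ 3 + algebraMap F _ W.a₂ * x ^ 2 + algebraMap F _ W.a₄ * x
        + algebraMap F _ W.a₆ ∧
      algebraMap F _ (l 0) * x + algebraMap F _ (l 1) * y + algebraMap F _ (l 2) = 0 ∧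
      -(3 * x ^ 2 + 2 * algebraMap F _ W.a₂ * x + algebraMap F _ W.a₄)
        = t * algebraMap F _ (l 0) ∧
      2 * y = t * algebraMap F _ (l 1) := by
  obtain ⟨v, hv, hc, hs, t, ht, hg⟩ := h
  have hg0 := congrFun hg 0
  have hg1 := congrFun hg 1
  simp [cubicEval, gradEval, ha₁, ha₃, Fin.sum_univ_three] at hc hs hg0 hg1
  have hz : v 2 ≠ 0 := by
    intro hz
    have hx : v 0 = 0 := by simpa [hz] using hc
    simp only [hz, hx] at hg0 hg1
    rcases hl with hl | hl
    · exact hl (by simpa [ht] using hg0.symm)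
    · exact hl (by simpa [ht] using hg1.symm)
  refine ⟨v 0 / v 2, v 1 / v 2, t / v 2 ^ 2, ?_, ?_, ?_, ?_⟩
  · field_simp
    linear_combination hc
  · field_simp
    linear_combination hs
  · field_simp
    linear_combination hg0
  · field_simp
    linear_combination hg1

/-- The line `y = m x + k` can be tangent only if `x³ + a₂x² + a₄x + a₆ - (m x + k)²` has
discriminant zero. -/
lemma IsTangentLine.disc_eq_zero {W : WeierstrassCurve F} (ha₁ : W.a₁ = 0) (ha₃ : W.a₃ = 0)
    {l : Fin 3 → F} (h : IsTangentLine W l) (hl : l 1 ≠ 0) {m k : F}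
    (hm : m = -l 0 / l 1) (hk : k = -l 2 / l 1) :
    monicCubicDisc (W.a₂ - m ^ 2) (W.a₄ - 2 * m * k) (W.a₆ - k ^ 2) = 0 := by
  obtain ⟨x, y, t, hc, hs, h0, h1⟩ := h.exists_affine ha₁ ha₃ (Or.inr hl)
  have e0 : l 0 = -m * l 1 := by rw [hm]; field_simp
  have e2 : l 2 = -k * l 1 := by rw [hk]; field_simp
  have hl' : algebraMap F (AlgebraicClosure F) (l 1) ≠ 0 := by simpa using hl
  rw [e0] at hs h0
  rw [e2] at hs
  simp only [map_mul, map_neg] at hs h0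
  have hy : y = algebraMap F _ m * x + algebraMap F _ k :=
    mul_left_cancel₀ hl' (by linear_combination hs)
  subst hy
  apply (algebraMap F (AlgebraicClosure F)).injective
  have := monicCubicDisc_eq_zero (r := algebraMap F (AlgebraicClosure F) (W.a₂ - m ^ 2))
    (s := algebraMap F _ (W.a₄ - 2 * m * k)) (u := algebraMap F _ (W.a₆ - k ^ 2)) (x := x)
    (by simp only [map_sub, map_mul, map_pow, map_ofNat]; linear_combination -hc)
    (by simp only [map_sub, map_mul, map_pow, map_ofNat]
        linear_combination -h0 - algebraMap F _ m * h1)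
  simpa only [monicCubicDisc, map_add, map_sub, map_mul, map_pow, map_ofNat, map_zero] using this

/-- A vertical line `x = p` can be tangent only at a point of order two. -/
lemma IsTangentLine.cubic_eq_zero {W : WeierstrassCurve F} (h2 : (2 : F) ≠ 0)
    (ha₁ : W.a₁ = 0) (ha₃ : W.a₃ = 0) {l : Fin 3 → F} (h : IsTangentLine W l)
    (hl0 : l 0 ≠ 0) (hl1 : l 1 = 0) {p : F} (hp : l 0 * p + l 2 = 0) :
    p ^ 3 + W.a₂ * p ^ 2 + W.a₄ * p + W.a₆ = 0 := by
  obtain ⟨x, y, t, hc, hs, -, h1⟩ := h.exists_affine ha₁ ha₃ (Or.inl hl0)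
  have hl' : algebraMap F (AlgebraicClosure F) (l 0) ≠ 0 := by simpa using hl0
  have h2' : (2 : AlgebraicClosure F) ≠ 0 := by
    rw [← map_ofNat (algebraMap F (AlgebraicClosure F)) 2]
    exact (map_ne_zero _).mpr h2
  have hy : y = 0 := by simpa [hl1, h2'] using h1
  have hp' := congrArg (algebraMap F (AlgebraicClosure F)) hp
  simp only [map_add, map_mul, map_zero] at hp'
  have hx : x = algebraMap F _ p := mul_left_cancel₀ hl' (by
    rw [hl1, map_zero] at hs
    linear_combination hs - hp')
  subst hx hy
  apply (algebraMap F (AlgebraicClosure F)).injective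
  simp only [map_add, map_mul, map_pow, map_zero]
  linear_combination -hc

/-- Coefficients, in the slope `m`, of the discriminant of `x³ + a x² + b x + c - (m x + q)²`. -/
def slopeCoeffs (a b c q : F) : Fin 7 → F :=
  ![a ^ 2 * b ^ 2 - 4 * b ^ 3 - 4 * a ^ 3 * (c - q ^ 2) - 27 * (c - q ^ 2) ^ 2
      + 18 * a * b * (c - q ^ 2),
    -4 * a ^ 2 * b * q + 24 * b ^ 2 * q - 36 * a * q * (c - q ^ 2),
    -2 * a * b ^ 2 + 4 * a ^ 2 * q ^ 2 - 48 * b * q ^ 2 + 12 * a ^ 2 * (c - q ^ 2)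
      - 18 * b * (c - q ^ 2),
    8 * a * b * q + 32 * q ^ 3 + 36 * (c - q ^ 2) * q,
    b ^ 2 - 8 * a * q ^ 2 - 12 * a * (c - q ^ 2),
    -4 * b * q,
    4 * c]

lemma sum_slopeCoeffs (a b c q m : F) :
    ∑ i, slopeCoeffs a b c q i * m ^ (i : ℕ)
      = monicCubicDisc (a - m ^ 2) (b - 2 * m * q) (c - q ^ 2) := by
  simp [Fin.sum_univ_succ, slopeCoeffs, monicCubicDisc]
  ring

/-- Coefficients, in the intercept `k`, of the discriminant of
`x³ + a x² + b x + c - (m x + k)²`. -/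
def interceptCoeffs (a b c m : F) : Fin 5 → F :=
  ![(a - m ^ 2) ^ 2 * b ^ 2 - 4 * b ^ 3 - 4 * (a - m ^ 2) ^ 3 * c - 27 * c ^ 2
      + 18 * (a - m ^ 2) * b * c,
    -4 * b * m * (a - m ^ 2) ^ 2 + 24 * b ^ 2 * m - 36 * (a - m ^ 2) * m * c,
    4 * m ^ 2 * (a - m ^ 2) ^ 2 - 48 * b * m ^ 2 + 4 * (a - m ^ 2) ^ 3 + 54 * c
      - 18 * (a - m ^ 2) * b,
    32 * m ^ 3 + 36 * (a - m ^ 2) * m,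
    -27]

lemma sum_interceptCoeffs (a b c m k : F) :
    ∑ i, interceptCoeffs a b c m i * k ^ (i : ℕ)
      = monicCubicDisc (a - m ^ 2) (b - 2 * m * k) (c - k ^ 2) := by
  simp [Fin.sum_univ_succ, interceptCoeffs, monicCubicDisc]
  ring

lemma interceptCoeffs_ne_zero (h2 : (2 : F) ≠ 0) {a b c : F} (h : monicCubicDisc a b c ≠ 0)
    (m : F) : interceptCoeffs a b c m ≠ 0 := by
  intro h0
  have e0 := congrFun h0 0
  have e2 := congrFun h0 2
  have e3 := congrFun h0 3
  have e4 := congrFun h0 4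
  simp only [interceptCoeffs, Matrix.cons_val, Pi.zero_apply] at e0 e2 e3 e4
  have h3 : (3 : F) = 0 := pow_eq_zero_iff (n := 3) (by norm_num) |>.mp (by linear_combination -e4)
  have hm : m = 0 := by
    have : (2 * m) ^ 3 * 2 ^ 2 = 0 := by
      linear_combination e3 - 12 * (a - m ^ 2) * m * h3
    simpa [h2] using this
  subst hm
  have ha : a = 0 := by
    have : 2 ^ 2 * a ^ 3 = 0 := by linear_combination e2 - (18 * c - 6 * a * b) * h3
    simpa [h2] using this
  subst ha
  exact h (by rw [monicCubicDisc]; linear_combination e0)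

/-- Bound a set of lines by counting those with equation `y = m x + k` through a parameter `g`. -/
lemma ncard_lines_le {S : Set (Projectivization F (Fin 3 → F))} {Z : Set F}
    (g : Projectivization F (Fin 3 → F) → F)
    (hmap : ∀ L ∈ S, L.rep 1 ≠ 0 → g L ∈ Z)
    (hinj : ∀ L ∈ S, L.rep 1 ≠ 0 → ∀ M ∈ S, M.rep 1 ≠ 0 → g L = g M → L = M) :
    S.ncard ≤ Z.ncard + {L ∈ S | L.rep 1 = 0}.ncard := by
  have hS : S = {L ∈ S | L.rep 1 ≠ 0} ∪ {L ∈ S | L.rep 1 = 0} := by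
    ext L
    by_cases h : L.rep 1 = 0 <;> simp [h]
  calc S.ncard ≤ {L ∈ S | L.rep 1 ≠ 0}.ncard + {L ∈ S | L.rep 1 = 0}.ncard := by
        conv_lhs => rw [hS]
        exact Set.ncard_union_le _ _
    _ ≤ _ := by
        gcongr
        exact Set.ncard_le_ncard_of_injOn g (fun L hL => hmap L hL.1 hL.2)
          (fun L hL M hM h => hinj L hL.1 hL.2 M hM.1 hM.2 h) Z.toFinite

lemma subsingleton_vertical {P : Projectivization F (Fin 3 → F)}
    (hP : P.rep 0 ≠ 0 ∨ P.rep 2 ≠ 0) :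
    {L : Projectivization F (Fin 3 → F) | OnHyp L.rep P ∧ L.rep 1 = 0}.Subsingleton := by
  rintro L ⟨hL, hL1⟩ M ⟨hM, hM1⟩
  simp only [OnHyp, Fin.sum_univ_three, hL1, hM1, zero_mul, add_zero] at hL hM
  have hne := M.rep_nonzero
  rcases hP with h | h
  · have hM2 : M.rep 2 ≠ 0 := by
      intro h0
      have hM0 : M.rep 0 = 0 := by simpa [h0, h] using hM
      exact hne (by ext i; fin_cases i <;> simp [h0, hM0, hM1])
    refine eq_of_rep_eq_mul (L.rep 2 / M.rep 2) ?_ (by rw [hL1, hM1, mul_zero]) (by field_simp)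
    field_simp
    exact mul_left_cancel₀ h (by linear_combination M.rep 2 * hL - L.rep 2 * hM)
  · have hM0 : M.rep 0 ≠ 0 := by
      intro h0
      have hM2 : M.rep 2 = 0 := by simpa [h0, h] using hM
      exact hne (by ext i; fin_cases i <;> simp [h0, hM2, hM1])
    refine eq_of_rep_eq_mul (L.rep 0 / M.rep 0) (by field_simp) (by rw [hL1, hM1, mul_zero]) ?_
    field_simp
    exact mul_left_cancel₀ h (by linear_combination M.rep 0 * hL - L.rep 0 * hM)

/-- Tangent lines through a point at infinity off the curve. -/
lemma ncard_tangents_le_of_infinity (h2 : (2 : F) ≠ 0) {W : WeierstrassCurve F}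
    (ha₁ : W.a₁ = 0) (ha₃ : W.a₃ = 0) [W.IsElliptic]
    {P : Projectivization F (Fin 3 → F)} (hP0 : P.rep 0 ≠ 0) (hP2 : P.rep 2 = 0) :
    {L : Projectivization F (Fin 3 → F) | OnHyp L.rep P ∧ IsTangentLine W L.rep}.ncard ≤ 5 := by
  have hslope (L : Projectivization F (Fin 3 → F)) (hL : OnHyp L.rep P) (hL1 : L.rep 1 ≠ 0) :
      P.rep 1 / P.rep 0 = -L.rep 0 / L.rep 1 := by
    simp only [OnHyp, Fin.sum_univ_three, hP2] at hL
    field_simp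
    linear_combination hL
  refine (ncard_lines_le (fun L => -L.rep 2 / L.rep 1)
    (Z := {k | ∑ i, interceptCoeffs W.a₂ W.a₄ W.a₆ (P.rep 1 / P.rep 0) i * k ^ (i : ℕ) = 0})
    (fun L hL hL1 => ?_) (fun L hL hL1 M hM hM1 h => ?_)).trans
    (Nat.add_le_add (ncard_zeros_le _ (interceptCoeffs_ne_zero h2 (disc_ne_zero ha₁ ha₃) _))
      (Set.ncard_le_one_iff_subsingleton.mpr
        ((subsingleton_vertical (Or.inl hP0)).anti fun L hL => ⟨hL.1.1, hL.2⟩)))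
  · rw [Set.mem_ofPred_eq, sum_interceptCoeffs]
    exact hL.2.disc_eq_zero ha₁ ha₃ hL1 (hslope L hL.1 hL1) rfl
  · exact eq_of_slope_eq_of_intercept_eq hL1 hM1
      ((hslope L hL.1 hL1).symm.trans (hslope M hM.1 hM1)) h

/-- Tangent lines through an affine point off the curve. -/
lemma ncard_tangents_le_of_affine (h2 : (2 : F) ≠ 0) {W : WeierstrassCurve F}
    (ha₁ : W.a₁ = 0) (ha₃ : W.a₃ = 0) [W.IsElliptic]
    {P : Projectivization F (Fin 3 → F)} (hP : ¬ OnCurve W P) (hP2 : P.rep 2 ≠ 0) :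
    {L : Projectivization F (Fin 3 → F) | OnHyp L.rep P ∧ IsTangentLine W L.rep}.ncard ≤ 6 := by
  obtain ⟨p, hp⟩ : ∃ p, P.rep 0 = p * P.rep 2 := ⟨P.rep 0 / P.rep 2, by field_simp⟩
  obtain ⟨q, hq⟩ : ∃ q, P.rep 1 = q * P.rep 2 := ⟨P.rep 1 / P.rep 2, by field_simp⟩
  have hon {L : Projectivization F (Fin 3 → F)} (hL : OnHyp L.rep P) :
      L.rep 0 * p + L.rep 1 * q + L.rep 2 = 0 := by
    simp only [OnHyp, Fin.sum_univ_three, hp, hq] at hL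
    exact mul_left_cancel₀ hP2 (by linear_combination hL)
  have hint {L : Projectivization F (Fin 3 → F)} (hL : OnHyp L.rep P) (hL1 : L.rep 1 ≠ 0) :
      q - -L.rep 0 / L.rep 1 * p = -L.rep 2 / L.rep 1 := by
    field_simp
    linear_combination hon hL
  set a := 3 * p + W.a₂ with ha
  set b := 3 * p ^ 2 + 2 * W.a₂ * p + W.a₄ with hb
  set c := p ^ 3 + W.a₂ * p ^ 2 + W.a₄ * p + W.a₆ with hc
  have hbound := ncard_lines_le (fun L => -L.rep 0 / L.rep 1)
    (S := {L | OnHyp L.rep P ∧ IsTangentLine W L.rep})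
    (Z := {m | ∑ i, slopeCoeffs a b c q i * m ^ (i : ℕ) = 0})
    (fun L hL hL1 => by
      rw [Set.mem_ofPred_eq, sum_slopeCoeffs,
        ← hL.2.disc_eq_zero ha₁ ha₃ hL1 rfl (hint hL.1 hL1)]
      simp only [monicCubicDisc, ha, hb, hc]
      ring)
    (fun L hL hL1 M hM hM1 h => eq_of_slope_eq_of_intercept_eq hL1 hM1 h (by
      rw [← hint hL.1 hL1, ← hint hM.1 hM1]
      rw [h]))
  by_cases hc0 : c = 0
  · have hq0 : q ≠ 0 := by
      rintro rfl
      apply hP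
      simp only [OnCurve, cubicEval, hp, hq, ha₁, ha₃]
      linear_combination -P.rep 2 ^ 3 * hc0
    have hb0 : b ≠ 0 := fun hb0 => disc_ne_zero ha₁ ha₃ (monicCubicDisc_eq_zero hc0 hb0)
    have hcoeffs : (fun i : Fin 6 => slopeCoeffs a b c q i.castSucc) ≠ 0 := by
      intro h0
      have : -4 * b * q = 0 := congrFun h0 5
      have : 2 ^ 2 * b * q = 0 := by linear_combination -this
      simp [h2, hb0, hq0] at this
    have hlast : slopeCoeffs a b c q (Fin.last 6) = 0 := by
      change 4 * c = 0
      rw [hc0, mul_zero]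
    simp only [Fin.sum_univ_castSucc (n := 6), hlast, zero_mul, add_zero] at hbound
    exact hbound.trans (Nat.add_le_add (ncard_zeros_le _ hcoeffs)
      (Set.ncard_le_one_iff_subsingleton.mpr
        ((subsingleton_vertical (Or.inr hP2)).anti fun L hL => ⟨hL.1.1, hL.2⟩)))
  · have hcoeffs : slopeCoeffs a b c q ≠ 0 := by
      intro h0
      have : 4 * c = 0 := congrFun h0 6
      have : 2 ^ 2 * c = 0 := by linear_combination this
      simp [h2, hc0] at this
    have hvert : {L ∈ {L : Projectivization F (Fin 3 → F) |
        OnHyp L.rep P ∧ IsTangentLine W L.rep} | L.rep 1 = 0} = ∅ := by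
      rw [Set.eq_empty_iff_forall_notMem]
      rintro L ⟨⟨hL, hT⟩, hL1⟩
      have h := hon hL
      rw [hL1, zero_mul, add_zero] at h
      have hL0 : L.rep 0 ≠ 0 := by
        intro h0
        have hL2 : L.rep 2 = 0 := by simpa [h0] using h
        exact L.rep_nonzero (by ext i; fin_cases i <;> simp [h0, hL1, hL2])
      exact hc0 (hT.cubic_eq_zero h2 ha₁ ha₃ hL0 hL1 h)
    rw [hvert, Set.ncard_empty] at hbound
    exact hbound.trans (ncard_zeros_le _ hcoeffs)

/-- Let `q` be odd and `E : Y² = X³ + aX² + bX + c` a nonsingular cubic over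
`F_q`. Through every point `P ∈ P²(F_q)` not on `E` there pass at most `6` tangent lines
of `E`. -/
theorem statement4 (hodd : Odd (Fintype.card F))
    (W : WeierstrassCurve F) (ha₁ : W.a₁ = 0) (ha₃ : W.a₃ = 0) [W.IsElliptic]
    (P : Projectivization F (Fin 3 → F)) (hP : ¬ OnCurve W P) :
    Set.ncard {L : Projectivization F (Fin 3 → F) |
      OnHyp L.rep P ∧ IsTangentLine W L.rep} ≤ 6 := by
  have h2 := two_ne_zero_of_odd_card hodd
  by_cases hP2 : P.rep 2 = 0
  · have hP0 : P.rep 0 ≠ 0 := fun h => hP (by simp [OnCurve, cubicEval, h, hP2])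
    exact (ncard_tangents_le_of_infinity h2 ha₁ ha₃ hP0 hP2).trans (by norm_num)
  · exact ncard_tangents_le_of_affine h2 ha₁ ha₃ hP hP2

end NMDS
end
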